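/- arXiv:1503.04710 — 9 statements merged into one kernel-verified Lean document; each statement's English description precedes it below -/
import Mathlib

section
/- Let Q be a 2m×2m nonnegative bisymmetric real matrix with Perron root λ0, written in block form Q = [[A, JCJ],[C, JAJ]] where A and C are m×m real matrices with Aᵀ = A and Cᵀ = JCJ (J the m×m reverse identity matrix). Then λ0 is the Perron root of the m×m matrix A + JC. -/
open Matrix Polynomial BigOperators

/-- The `n × n` reverse identity (exchange) matrix `J`, with entry `1` in
positions `(i, j)` with `i + j = n - 1` (0-based) and `0` elsewhere. -/
def revId (n : ℕ) : Matrix (Fin n) (Fin n) ℝ :=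
  Matrix.of fun i j => if (i : ℕ) + (j : ℕ) + 1 = n then 1 else 0

/-- A square real matrix `Q` is bisymmetric if `Qᵀ = Q` and `JQJ = Q`. -/
def IsBisymm {n : ℕ} (Q : Matrix (Fin n) (Fin n) ℝ) : Prop :=
  Qᵀ = Q ∧ revId n * Q * revId n = Q

/-- Entrywise nonnegative matrix. -/
def MatNonneg {n : ℕ} (Q : Matrix (Fin n) (Fin n) ℝ) : Prop :=
  ∀ i j, 0 ≤ Q i j

/-- Entrywise positive matrix. -/
def MatPos {n : ℕ} (Q : Matrix (Fin n) (Fin n) ℝ) : Prop :=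
  ∀ i j, 0 < Q i j

/-- `lam 0, …, lam (n-1)` are the eigenvalues of `Q` with multiplicity, i.e. the
characteristic polynomial of `Q` is `∏ i (X - lam i)`. -/
def HasEigs {n : ℕ} (Q : Matrix (Fin n) (Fin n) ℝ) (lam : Fin n → ℝ) : Prop :=
  Q.charpoly = ∏ i, (X - Polynomial.C (lam i))

/-- The multiset `μ` is the multiset of eigenvalues (with multiplicity) of `Q`. -/
def HasEigsM {n : ℕ} (Q : Matrix (Fin n) (Fin n) ℝ) (μ : Multiset ℝ) : Prop :=
  Q.charpoly = (μ.map fun a => X - Polynomial.C a).prod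

/-- `r` is the Perron root of `Q`: it is a (real) eigenvalue of `Q` which equals the
spectral radius of `Q`, i.e. every complex eigenvalue of `Q` has modulus at most `r`. -/
def IsPerronRoot {n : ℕ} (Q : Matrix (Fin n) (Fin n) ℝ) (r : ℝ) : Prop :=
  r ∈ spectrum ℝ Q ∧ ∀ μ ∈ spectrum ℂ (Q.map fun a => (a : ℂ)), ‖μ‖ ≤ r

theorem aux_spec_iff {K n : Type*} [Field K] [Fintype n] [DecidableEq n] (M : Matrix n n K)
    (μ : K) : μ ∈ spectrum K M ↔ ∃ v : n → K, v ≠ 0 ∧ M *ᵥ v = μ • v := by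
  rw [← Matrix.spectrum_toLin', ← Module.End.hasEigenvalue_iff_mem_spectrum]
  constructor
  · intro h
    obtain ⟨v, hv⟩ := h.exists_hasEigenvector
    exact ⟨v, hv.2, by simpa using hv.apply_eq_smul⟩
  · rintro ⟨v, hv, h⟩
    exact Module.End.hasEigenvalue_of_hasEigenvector
      (x := v) ⟨by rw [Module.End.mem_eigenspace_iff]; simpa using h, hv⟩

theorem aux_block {K : Type*} [Field K] {m : ℕ} (A C J : Matrix (Fin m) (Fin m) K)
    (hJ : J * J = 1) (μ : K) (h : μ ∈ spectrum K (A + J * C)) :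
    μ ∈ spectrum K (fromBlocks A (J * C * J) C (J * A * J)) := by
  rw [aux_spec_iff] at h ⊢
  obtain ⟨v, hv, h⟩ := h
  refine ⟨Sum.elim v (J *ᵥ v), ?_, ?_⟩
  · intro h0
    apply hv
    funext i
    exact congrFun h0 (Sum.inl i)
  · rw [fromBlocks_mulVec]
    have h1 : (J * C * J) *ᵥ (J *ᵥ v) = (J * C) *ᵥ v := by
      rw [mulVec_mulVec, Matrix.mul_assoc, hJ, Matrix.mul_one]
    have h2 : (J * A * J) *ᵥ (J *ᵥ v) = (J * A) *ᵥ v := by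
      rw [mulVec_mulVec, Matrix.mul_assoc, hJ, Matrix.mul_one]
    have h3 : C *ᵥ v + (J * A) *ᵥ v = J *ᵥ ((A + J * C) *ᵥ v) := by
      rw [mulVec_mulVec, Matrix.mul_add, ← Matrix.mul_assoc, hJ, Matrix.one_mul, add_mulVec,
        add_comm]
    simp only [Sum.elim_comp_inl, Sum.elim_comp_inr]
    rw [h1, h2, h3, ← add_mulVec, h, mulVec_smul]
    funext i
    cases i <;> simp

theorem aux_spec_map {n : Type*} [Fintype n] [DecidableEq n] (M : Matrix n n ℝ) (μ : ℝ)
    (h : μ ∈ spectrum ℝ M) : (μ : ℂ) ∈ spectrum ℂ (M.map fun a => (a : ℂ)) := by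
  rw [aux_spec_iff] at h ⊢
  obtain ⟨v, hv, h⟩ := h
  refine ⟨fun i => (v i : ℂ), ?_, ?_⟩
  · intro h0
    apply hv
    funext i
    simpa using congrFun h0 i
  · funext i
    have := congrFun h i
    simp only [mulVec, dotProduct, Pi.smul_apply, smul_eq_mul, Matrix.map_apply] at this ⊢
    exact_mod_cast this

theorem aux_spec_reindex {K n k : Type*} [Field K] [Fintype n] [DecidableEq n]
    [Fintype k] [DecidableEq k] (e : n ≃ k) (M : Matrix n n K) :
    spectrum K (Matrix.reindex e e M) = spectrum K M :=
  AlgEquiv.spectrum_eq (Matrix.reindexAlgEquiv K K e) M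

theorem aux_revId_apply (m : ℕ) (i j : Fin m) :
    revId m i j = if j = Fin.rev i then 1 else 0 := by
  simp only [revId, Matrix.of_apply]
  congr 1
  rw [Fin.ext_iff, Fin.val_rev, eq_iff_iff]
  omega

theorem aux_revId_mul (m : ℕ) (M : Matrix (Fin m) (Fin m) ℝ) (i j : Fin m) :
    (revId m * M) i j = M (Fin.rev i) j := by
  simp [Matrix.mul_apply, aux_revId_apply]

theorem aux_revId_sq (m : ℕ) : revId m * revId m = 1 := by
  ext i j
  rw [aux_revId_mul, aux_revId_apply, Fin.rev_rev, Matrix.one_apply]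
  simp [eq_comm]

theorem aux_revId_tr (m : ℕ) : (revId m)ᵀ = revId m := by
  ext i j
  simp only [revId, Matrix.transpose_apply, Matrix.of_apply]
  congr 1
  rw [eq_iff_iff]
  omega

/-- If `B` is symmetric with all eigenvalues at most `r`, and `|D| ≤ B` entrywise has
eigenvalue `r`, then so does `B`. -/
theorem aux_dom {m : ℕ} (B D : Matrix (Fin m) (Fin m) ℝ) (hB : Bᵀ = B) (r : ℝ)
    (hs : ∀ μ ∈ spectrum ℝ B, μ ≤ r) (hD : ∀ i j, |D i j| ≤ B i j)
    (x : Fin m → ℝ) (hx : x ≠ 0) (h : D *ᵥ x = r • x) : r ∈ spectrum ℝ B := by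
  have hH : (r • (1 : Matrix (Fin m) (Fin m) ℝ) - B).IsHermitian := by
    rw [Matrix.IsHermitian, Matrix.conjTranspose_eq_transpose_of_trivial]
    simp [hB]
  have hP : (r • (1 : Matrix (Fin m) (Fin m) ℝ) - B).PosSemidef := by
    rw [Matrix.posSemidef_iff_isHermitian_and_spectrum_nonneg]
    refine ⟨hH, fun μ hμ => ?_⟩
    rw [aux_spec_iff] at hμ
    obtain ⟨v, hv, hμ⟩ := hμ
    have : r - μ ∈ spectrum ℝ B := by
      rw [aux_spec_iff]
      refine ⟨v, hv, ?_⟩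
      rw [sub_mulVec, smul_mulVec, one_mulVec] at hμ
      rw [sub_smul, ← hμ]
      abel
    have := hs _ this
    show 0 ≤ μ
    linarith
  set y : Fin m → ℝ := fun i => |x i| with hy
  have hyx : y ⬝ᵥ y = x ⬝ᵥ x := by
    simp [dotProduct, hy, abs_mul_abs_self]
  have h1 : x ⬝ᵥ D *ᵥ x ≤ y ⬝ᵥ B *ᵥ y := by
    simp only [dotProduct, mulVec, Finset.mul_sum]
    refine Finset.sum_le_sum fun i _ => Finset.sum_le_sum fun j _ => ?_
    calc x i * (D i j * x j) ≤ |x i * (D i j * x j)| := le_abs_self _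
      _ = |x i| * (|D i j| * |x j|) := by rw [abs_mul, abs_mul]
      _ ≤ |x i| * (B i j * |x j|) := by
        have := hD i j
        gcongr
  rw [h, dotProduct_smul, smul_eq_mul, ← hyx] at h1
  have h2 := hP.dotProduct_mulVec_nonneg y
  have h3 : star y ⬝ᵥ (r • (1 : Matrix (Fin m) (Fin m) ℝ) - B) *ᵥ y
      = r * (y ⬝ᵥ y) - y ⬝ᵥ B *ᵥ y := by
    rw [sub_mulVec, smul_mulVec, one_mulVec, dotProduct_sub, dotProduct_smul, star_trivial,
      smul_eq_mul]
  have h4 := (hP.dotProduct_mulVec_zero_iff y).1 (le_antisymm (by rw [h3]; linarith) h2)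
  rw [aux_spec_iff]
  refine ⟨y, ?_, ?_⟩
  · intro h0
    apply hx
    funext i
    simpa [hy] using congrFun h0 i
  · rw [sub_mulVec, smul_mulVec, one_mulVec] at h4
    exact (sub_eq_zero.1 h4).symm

/-- Let `Q` be a `2m × 2m` nonnegative bisymmetric real matrix with Perron root `λ₀`,
written in block form `Q = [[A, JCJ], [C, JAJ]]` with `Aᵀ = A` and `Cᵀ = JCJ`.
Then `λ₀` is the Perron root of `A + JC`. -/
theorem perron_root_even_block (m : ℕ) (A Cm : Matrix (Fin m) (Fin m) ℝ)
    (hA : Aᵀ = A) (hC : Cmᵀ = revId m * Cm * revId m)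
    (Q : Matrix (Fin (m + m)) (Fin (m + m)) ℝ)
    (hQ : Q = (Matrix.reindex finSumFinEquiv finSumFinEquiv)
      (Matrix.fromBlocks A (revId m * Cm * revId m) Cm (revId m * A * revId m)))
    (hQnn : MatNonneg Q) (hQbs : IsBisymm Q)
    (lam0 : ℝ) (hperron : IsPerronRoot Q lam0) :
    IsPerronRoot (A + revId m * Cm) lam0 := by
  obtain ⟨hp1, hp2⟩ := hperron
  have hJ := aux_revId_sq m
  have hJt := aux_revId_tr m
  have hnnA : ∀ i j, 0 ≤ A i j := fun i j => by
    have := hQnn (finSumFinEquiv (Sum.inl i)) (finSumFinEquiv (Sum.inl j))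
    rw [hQ] at this
    simpa only [reindex_apply, submatrix_apply, Equiv.symm_apply_apply, fromBlocks_apply₁₁]
      using this
  have hnnC : ∀ i j, 0 ≤ Cm i j := fun i j => by
    have := hQnn (finSumFinEquiv (Sum.inr i)) (finSumFinEquiv (Sum.inl j))
    rw [hQ] at this
    simpa only [reindex_apply, submatrix_apply, Equiv.symm_apply_apply, fromBlocks_apply₂₁]
      using this
  have hbound : ∀ μ ∈ spectrum ℂ ((A + revId m * Cm).map fun a => (a : ℂ)), ‖μ‖ ≤ lam0 := by
    intro μ hμ
    apply hp2
    have hmul : ∀ M N : Matrix (Fin m) (Fin m) ℝ, (M * N).map (fun a => (a : ℂ))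
        = M.map (fun a => (a : ℂ)) * N.map (fun a => (a : ℂ)) := fun M N =>
      Matrix.map_mul (f := Complex.ofRealHom)
    have hadd : ∀ M N : Matrix (Fin m) (Fin m) ℝ, (M + N).map (fun a => (a : ℂ))
        = M.map (fun a => (a : ℂ)) + N.map (fun a => (a : ℂ)) := fun M N => by
      ext i j; simp
    have hJC : (revId m).map (fun a => (a : ℂ)) * (revId m).map (fun a => (a : ℂ)) = 1 := by
      rw [← hmul, hJ]
      ext i j
      by_cases hij : i = j <;> simp [Matrix.one_apply, hij]
    rw [hadd, hmul] at hμ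
    have := aux_block _ _ _ hJC μ hμ
    rw [← hmul, ← hmul, ← hmul, ← hmul, ← fromBlocks_map,
      ← aux_spec_reindex (finSumFinEquiv (m := m) (n := m))] at this
    rw [hQ]
    exact this
  refine ⟨?_, hbound⟩
  have hs : ∀ μ ∈ spectrum ℝ (A + revId m * Cm), μ ≤ lam0 := fun μ hμ => by
    have := hbound _ (aux_spec_map _ _ hμ)
    rw [Complex.norm_real] at this
    exact (le_abs_self μ).trans this
  have hBt : (A + revId m * Cm)ᵀ = A + revId m * Cm := by
    rw [transpose_add, transpose_mul, hA, hC, hJt, Matrix.mul_assoc, hJ, Matrix.mul_one]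
  rw [hQ, aux_spec_reindex, aux_spec_iff] at hp1
  obtain ⟨u, hu, he⟩ := hp1
  rw [fromBlocks_mulVec] at he
  set x := u ∘ Sum.inl with hx
  set w := u ∘ Sum.inr with hw
  have e1 : A *ᵥ x + (revId m * Cm) *ᵥ (revId m *ᵥ w) = lam0 • x := by
    rw [mulVec_mulVec]
    funext i
    exact congrFun he (Sum.inl i)
  have e2 : Cm *ᵥ x + (revId m * A * revId m) *ᵥ w = lam0 • w := by
    funext i
    exact congrFun he (Sum.inr i)
  have e3 : (revId m * Cm) *ᵥ x + A *ᵥ (revId m *ᵥ w) = lam0 • (revId m *ᵥ w) := by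
    have := congrArg (fun t => revId m *ᵥ t) e2
    simp only [mulVec_add, mulVec_smul, mulVec_mulVec] at this
    rw [Matrix.mul_assoc (revId m), ← Matrix.mul_assoc (revId m) (revId m), hJ,
      Matrix.one_mul] at this
    rw [mulVec_mulVec]
    exact this
  by_cases hz : x + revId m *ᵥ w = 0
  · have hz' : revId m *ᵥ w = -x := (neg_eq_of_add_eq_zero_right hz).symm
    refine aux_dom _ (A - revId m * Cm) hBt lam0 hs ?_ x ?_ ?_
    · intro i j
      have h1 := hnnA i j
      have h2 := hnnC (Fin.rev i) j
      rw [Matrix.sub_apply, Matrix.add_apply, aux_revId_mul, abs_le]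
      constructor <;> linarith
    · intro hx0
      have hw0 : w = 0 := by
        have : revId m *ᵥ (revId m *ᵥ w) = 0 := by rw [hz', hx0]; simp
        rwa [mulVec_mulVec, hJ, one_mulVec] at this
      apply hu
      funext i
      cases i with
      | inl i => exact congrFun hx0 i
      | inr i => exact congrFun hw0 i
    · rw [sub_mulVec, ← e1, hz', mulVec_neg, sub_eq_add_neg]
  · rw [aux_spec_iff]
    refine ⟨_, hz, ?_⟩
    rw [smul_add, ← e1, ← e3, add_mulVec, mulVec_add, mulVec_add]
    abel
end

section
/- Let Q be a (2m+1)×(2m+1) nonnegative bisymmetric real matrix with Perron root λ0, written in block form Q = [[A, x, JCJ],[xᵀ, q, xᵀJ],[C, Jx, JAJ]] where A and C are m×m real matrices with Aᵀ = A and Cᵀ = JCJ, x is an m×1 column vector, and q is a real scalar. Then λ0 is the Perron root of the (m+1)×(m+1) matrix [[q, √2·xᵀ],[√2·x, A + JC]]. -/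
open Matrix Polynomial BigOperators

lemma revId_eq (n : ℕ) (i j : Fin n) : revId n i j = if j = i.rev then 1 else 0 := by
  unfold revId
  simp only [Matrix.of_apply, Fin.ext_iff, Fin.val_rev]
  congr 1
  apply propext
  omega

lemma revId_mul_apply' {n : ℕ} {ι : Type*} (M : Matrix (Fin n) ι ℝ) (i : Fin n) (j : ι) :
    (revId n * M) i j = M i.rev j := by
  simp [Matrix.mul_apply, revId_eq]

lemma mul_revId_apply' {n : ℕ} {ι : Type*} (M : Matrix ι (Fin n) ℝ) (i : ι) (j : Fin n) :
    (M * revId n) i j = M i j.rev := by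
  simp [Matrix.mul_apply, revId_eq, ← Fin.rev_eq_iff]

lemma mem_spectrum_iff_vec {K : Type*} [Field K] {n : ℕ} (M : Matrix (Fin n) (Fin n) K) (μ : K) :
    μ ∈ spectrum K M ↔ ∃ v : Fin n → K, v ≠ 0 ∧ ∀ i, ∑ j, M i j * v j = μ * v i := by
  rw [← Matrix.spectrum_toLin', ← Module.End.hasEigenvalue_iff_mem_spectrum]
  constructor
  · intro h
    obtain ⟨v, hv⟩ := h.exists_hasEigenvector
    refine ⟨v, hv.2, fun i => ?_⟩
    have := congrFun hv.apply_eq_smul i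
    simpa [Matrix.mulVec, dotProduct] using this
  · rintro ⟨v, hv, h⟩
    apply Module.End.hasEigenvalue_of_hasEigenvector (x := v)
    refine ⟨Module.End.mem_eigenspace_iff.2 ?_, hv⟩
    funext i
    simpa [Matrix.mulVec, dotProduct] using h i

/-- A symmetric nonnegative matrix with Perron root `r` has a nonnegative eigenvector. -/
lemma exists_nonneg_vec {n : ℕ} (Q : Matrix (Fin n) (Fin n) ℝ) (hs : Qᵀ = Q) (hn : MatNonneg Q)
    (r : ℝ) (hr : IsPerronRoot Q r) :
    ∃ v : Fin n → ℝ, v ≠ 0 ∧ (∀ i, 0 ≤ v i) ∧ ∀ i, ∑ j, Q i j * v j = r * v i := by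
  obtain ⟨u, hu, hQu⟩ := (mem_spectrum_iff_vec Q r).1 hr.1
  have hle : ∀ μ ∈ spectrum ℝ Q, μ ≤ r := by
    intro μ hμ
    obtain ⟨v, hv, h⟩ := (mem_spectrum_iff_vec Q μ).1 hμ
    have := hr.2 (μ : ℂ) ((mem_spectrum_iff_vec _ _).2 ⟨fun i => (v i : ℂ), ?_, ?_⟩)
    · rw [Complex.norm_real] at this
      exact (le_abs_self μ).trans this
    · intro h0
      apply hv
      funext i
      have := congrFun h0 i
      simpa using this
    · intro i
      simp only [Matrix.map_apply]
      exact_mod_cast h i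
  have hpsd : (r • (1 : Matrix (Fin n) (Fin n) ℝ) - Q).PosSemidef := by
    rw [Matrix.posSemidef_iff_isHermitian_and_spectrum_nonneg]
    constructor
    · rw [Matrix.IsHermitian, Matrix.conjTranspose_eq_transpose_of_trivial]
      simp [hs]
    · intro μ hμ
      obtain ⟨v, hv, h⟩ := (mem_spectrum_iff_vec _ μ).1 hμ
      have := hle (r - μ) ((mem_spectrum_iff_vec _ _).2 ⟨v, hv, fun i => ?_⟩)
      · simpa using this
      · have := h i
        simp [sub_mul, Finset.sum_sub_distrib, Matrix.one_apply] at this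
        linarith
  refine ⟨fun i => |u i|, ?_, fun i => abs_nonneg _, ?_⟩
  · intro h0
    apply hu
    funext i
    have := congrFun h0 i
    simpa using this
  · have expand : ∀ (v : Fin n → ℝ) i, ((r • (1 : Matrix (Fin n) (Fin n) ℝ) - Q) *ᵥ v) i =
        r * v i - ∑ j, Q i j * v j := by
      intro v i
      rw [Matrix.sub_mulVec, Matrix.smul_mulVec, Matrix.one_mulVec]
      rfl
    have key : ∀ v : Fin n → ℝ, star v ⬝ᵥ (r • (1 : Matrix (Fin n) (Fin n) ℝ) - Q) *ᵥ v =
        r * ∑ i, v i * v i - ∑ i, ∑ j, v i * v j * Q i j := by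
      intro v
      simp only [dotProduct, expand, Finset.mul_sum, ← Finset.sum_sub_distrib, Pi.star_apply,
        star_trivial, mul_sub]
      refine Finset.sum_congr rfl fun i _ => ?_
      congr 1
      · ring
      · exact Finset.sum_congr rfl fun j _ => by ring
    have h0 : r * ∑ i, u i * u i - ∑ i, ∑ j, u i * u j * Q i j = 0 := by
      rw [sub_eq_zero, Finset.mul_sum]
      refine Finset.sum_congr rfl fun i _ => ?_
      have : ∑ j, u i * u j * Q i j = u i * ∑ j, Q i j * u j := by
        rw [Finset.mul_sum]
        exact Finset.sum_congr rfl fun j _ => by ring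
      rw [this, hQu]; ring
    have h1 : star (fun i => |u i|) ⬝ᵥ (r • (1 : Matrix (Fin n) (Fin n) ℝ) - Q) *ᵥ
        (fun i => |u i|) = 0 := by
      apply le_antisymm
      · rw [key, ← h0]
        simp only [abs_mul_abs_self]
        apply sub_le_sub_left
        refine Finset.sum_le_sum fun i _ => Finset.sum_le_sum fun j _ => ?_
        refine mul_le_mul_of_nonneg_right ?_ (hn i j)
        rw [← abs_mul]
        exact le_abs_self _
      · exact hpsd.dotProduct_mulVec_nonneg _
    have h2 := (hpsd.dotProduct_mulVec_zero_iff _).1 h1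
    intro i
    have := congrFun h2 i
    rw [expand, Pi.zero_apply] at this
    exact (sub_eq_zero.1 this).symm

/-- Let `Q` be a `(2m+1) × (2m+1)` nonnegative bisymmetric real matrix with Perron root `λ₀`,
written in block form `Q = [[A, x, JCJ], [xᵀ, q, xᵀJ], [C, Jx, JAJ]]` with `Aᵀ = A` and
`Cᵀ = JCJ`. Then `λ₀` is the Perron root of `[[q, √2·xᵀ], [√2·x, A + JC]]`. -/
theorem perron_root_odd_block (m : ℕ) (A Cm : Matrix (Fin m) (Fin m) ℝ)
    (x : Fin m → ℝ) (q : ℝ)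
    (hA : Aᵀ = A) (hC : Cmᵀ = revId m * Cm * revId m)
    (Q : Matrix (Fin (m + (1 + m))) (Fin (m + (1 + m))) ℝ)
    (hQ : Q = (Matrix.reindex
        ((Equiv.sumCongr (Equiv.refl (Fin m)) finSumFinEquiv).trans finSumFinEquiv)
        ((Equiv.sumCongr (Equiv.refl (Fin m)) finSumFinEquiv).trans finSumFinEquiv))
      (Matrix.fromBlocks A
        (Matrix.fromCols (Matrix.of fun i (_ : Fin 1) => x i) (revId m * Cm * revId m))
        (Matrix.fromRows (Matrix.of fun (_ : Fin 1) j => x j) Cm)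
        (Matrix.fromBlocks (Matrix.of fun (_ : Fin 1) (_ : Fin 1) => q)
          ((Matrix.of fun (_ : Fin 1) j => x j) * revId m)
          (revId m * (Matrix.of fun i (_ : Fin 1) => x i))
          (revId m * A * revId m))))
    (hQnn : MatNonneg Q) (hQbs : IsBisymm Q)
    (lam0 : ℝ) (hperron : IsPerronRoot Q lam0) :
    IsPerronRoot ((Matrix.reindex finSumFinEquiv finSumFinEquiv)
      (Matrix.fromBlocks (Matrix.of fun (_ : Fin 1) (_ : Fin 1) => q)
        (Matrix.of fun (_ : Fin 1) j => Real.sqrt 2 * x j)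
        (Matrix.of fun i (_ : Fin 1) => Real.sqrt 2 * x i)
        (A + revId m * Cm))) lam0 := by
  have q11 : ∀ i j, Q (Fin.castAdd _ i) (Fin.castAdd _ j) = A i j := by
    intro i j; simp [hQ]
  have q12 : ∀ i, Q (Fin.castAdd _ i) (Fin.natAdd m (Fin.castAdd m 0)) = x i := by
    intro i; simp [hQ]
  have q13 : ∀ i j, Q (Fin.castAdd _ i) (Fin.natAdd m (Fin.natAdd 1 j)) = Cm i.rev j.rev := by
    intro i j; simp [hQ, mul_revId_apply', revId_mul_apply']
  have q21 : ∀ j, Q (Fin.natAdd m (Fin.castAdd m 0)) (Fin.castAdd _ j) = x j := by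
    intro i; simp [hQ]
  have q22 : Q (Fin.natAdd m (Fin.castAdd m 0)) (Fin.natAdd m (Fin.castAdd m 0)) = q := by
    simp [hQ]
  have q23 : ∀ j, Q (Fin.natAdd m (Fin.castAdd m 0)) (Fin.natAdd m (Fin.natAdd 1 j))
      = x j.rev := by
    intro j; simp [hQ, mul_revId_apply']
  have q31 : ∀ i j, Q (Fin.natAdd m (Fin.natAdd 1 i)) (Fin.castAdd _ j) = Cm i j := by
    intro i j; simp [hQ]
  have q32 : ∀ i, Q (Fin.natAdd m (Fin.natAdd 1 i)) (Fin.natAdd m (Fin.castAdd m 0))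
      = x i.rev := by
    intro j; simp [hQ, revId_mul_apply']
  have q33 : ∀ i j, Q (Fin.natAdd m (Fin.natAdd 1 i)) (Fin.natAdd m (Fin.natAdd 1 j))
      = A i.rev j.rev := by
    intro i j; simp [hQ, mul_revId_apply', revId_mul_apply']
  have hrev : ∀ i j, Q i.rev j.rev = Q i j := by
    intro i j
    have := congrFun (congrFun hQbs.2 i) j
    simpa [mul_revId_apply', revId_mul_apply'] using this
  set M := ((Matrix.reindex finSumFinEquiv finSumFinEquiv)
      (Matrix.fromBlocks (Matrix.of fun (_ : Fin 1) (_ : Fin 1) => q)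
        (Matrix.of fun (_ : Fin 1) j => Real.sqrt 2 * x j)
        (Matrix.of fun i (_ : Fin 1) => Real.sqrt 2 * x i)
        (A + revId m * Cm))) with hM
  have m11 : M (Fin.castAdd m 0) (Fin.castAdd m 0) = q := by simp [hM]
  have m12 : ∀ j, M (Fin.castAdd m 0) (Fin.natAdd 1 j) = Real.sqrt 2 * x j := by
    intro j; simp [hM]
  have m21 : ∀ i, M (Fin.natAdd 1 i) (Fin.castAdd m 0) = Real.sqrt 2 * x i := by
    intro j; simp [hM]
  have m22 : ∀ i j, M (Fin.natAdd 1 i) (Fin.natAdd 1 j) = A i j + Cm i.rev j := by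
    intro i j; simp [hM, revId_mul_apply']
  clear_value M
  have hs2 : Real.sqrt 2 * Real.sqrt 2 = 2 := Real.mul_self_sqrt (by norm_num)
  have hs0 : Real.sqrt 2 ≠ 0 := by positivity
  have sumrev : ∀ {K : Type} [AddCommMonoid K] (f : Fin m → K), ∑ j : Fin m, f j.rev = ∑ j, f j :=
    fun f => Equiv.sum_comp Fin.revPerm f
  constructor
  · obtain ⟨v, hv0, hvn, hv⟩ := exists_nonneg_vec Q hQbs.1 hQnn lam0 hperron
    have hvr : ∀ i, ∑ j, Q i j * v j.rev = lam0 * v i.rev := by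
      intro i
      rw [← hv i.rev, ← Equiv.sum_comp Fin.revPerm (fun j => Q i.rev j * v j)]
      exact Finset.sum_congr rfl fun j _ => by simp [hrev]
    obtain ⟨w, hw⟩ : ∃ w : Fin (m + (1 + m)) → ℝ, w = fun i => v i + v i.rev := ⟨_, rfl⟩
    have hwr : ∀ i, w i.rev = w i := by intro i; simp [hw, add_comm]
    have hwe : ∀ i, ∑ j, Q i j * w j = lam0 * w i := by
      intro i
      simp only [hw, mul_add, Finset.sum_add_distrib, hv, hvr]
    have hw0 : w ≠ 0 := by
      intro h
      apply hv0
      funext i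
      have h1 : v i + v i.rev = 0 := by simpa [hw] using congrFun h i
      have h2 := hvn i
      have h3 := hvn i.rev
      show v i = 0
      linarith
    have hw3 : ∀ i : Fin m, w (Fin.natAdd m (Fin.natAdd 1 i)) = w (Fin.castAdd _ i.rev) := by
      intro i
      rw [← hwr]
      congr 1
      ext
      simp [Fin.val_rev]
      try omega
    simp only [Fin.sum_univ_add, Fin.sum_univ_one] at hwe
    rw [mem_spectrum_iff_vec]
    refine ⟨Fin.append (fun _ => w (Fin.natAdd m (Fin.castAdd m 0)) / Real.sqrt 2)
      (fun i => w (Fin.castAdd _ i)), ?_, ?_⟩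
    · intro h
      apply hw0
      have ht : ∀ i : Fin m, w (Fin.castAdd _ i) = 0 := by
        intro i
        simpa using congrFun h (Fin.natAdd 1 i)
      have hm : w (Fin.natAdd m (Fin.castAdd m 0)) = 0 := by
        have := congrFun h (Fin.castAdd m 0)
        simpa only [Fin.append_left, Pi.zero_apply, div_eq_zero_iff, hs0, or_false] using this
      funext i
      refine Fin.addCases (fun i => ht i) (fun i => ?_) i
      refine Fin.addCases (fun i => ?_) (fun i => ?_) i
      · rw [Subsingleton.elim i 0]; exact hm
      · rw [hw3]; exact ht _
    · intro i
      simp only [Fin.sum_univ_add, Fin.sum_univ_one, Fin.append_left, Fin.append_right]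
      refine Fin.addCases (fun i => ?_) (fun i => ?_) i
      · rw [Subsingleton.elim i 0]
        have := hwe (Fin.natAdd m (Fin.castAdd m 0))
        simp only [q21, q22, q23, hw3] at this
        rw [sumrev (fun j => x j * w (Fin.castAdd _ j))] at this
        simp only [m11, m12, Fin.append_left, mul_assoc, ← Finset.mul_sum]
        field_simp
        rw [pow_two, hs2]
        linarith
      · have := hwe (Fin.castAdd _ i)
        simp only [q11, q12, q13, hw3] at this
        rw [sumrev (fun j => Cm i.rev j * w (Fin.castAdd _ j))] at this
        simp only [m21, m22, Fin.append_right, add_mul, Finset.sum_add_distrib]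
        field_simp
        linarith
  · intro μ hμ
    apply hperron.2
    rw [mem_spectrum_iff_vec] at hμ ⊢
    obtain ⟨v, hv0, hv⟩ := hμ
    have hs2c : (Real.sqrt 2 : ℂ) * (Real.sqrt 2 : ℂ) = 2 := by exact_mod_cast hs2
    have hs0c : (Real.sqrt 2 : ℂ) ≠ 0 := by exact_mod_cast hs0
    simp only [Fin.sum_univ_add, Fin.sum_univ_one, Matrix.map_apply] at hv ⊢
    have e1 := hv (Fin.castAdd m 0)
    have e2 := fun i => hv (Fin.natAdd 1 i)
    simp only [m11, m12, m21, m22, Complex.ofReal_mul, Complex.ofReal_add, add_mul,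
      Finset.sum_add_distrib, mul_assoc, ← Finset.mul_sum] at e1 e2
    refine ⟨Fin.append (fun i => v (Fin.natAdd 1 i)) (Fin.append
      (fun _ => (Real.sqrt 2 : ℂ) * v (Fin.castAdd m 0)) (fun i => v (Fin.natAdd 1 i.rev))),
      ?_, ?_⟩
    · intro h
      apply hv0
      funext i
      refine Fin.addCases (fun i => ?_) (fun i => ?_) i
      · rw [Subsingleton.elim i 0]
        have := congrFun h (Fin.natAdd m (Fin.castAdd m 0))
        simpa only [Fin.append_left, Fin.append_right, Pi.zero_apply, mul_eq_zero, hs0c,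
          false_or] using this
      · have := congrFun h (Fin.castAdd _ i)
        simpa only [Fin.append_left, Pi.zero_apply] using this
    · intro i
      simp only [Fin.append_left, Fin.append_right]
      refine Fin.addCases (fun i => ?_) (fun i => ?_) i
      · simp only [q11, q12, q13, Fin.append_left]
        rw [sumrev (fun j => (Cm i.rev j : ℂ) * v (Fin.natAdd 1 j))]
        linear_combination e2 i
      · refine Fin.addCases (fun i => ?_) (fun i => ?_) i
        · rw [Subsingleton.elim i 0]
          simp only [q21, q22, q23, Fin.append_left, Fin.append_right]
          rw [sumrev (fun j => (x j : ℂ) * v (Fin.natAdd 1 j))]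
          linear_combination (Real.sqrt 2 : ℂ) * e1 -
            (∑ j, (x j : ℂ) * v (Fin.natAdd 1 j)) * hs2c
        · simp only [q31, q32, q33, Fin.append_right]
          rw [sumrev (fun j => (A i.rev j : ℂ) * v (Fin.natAdd 1 j))]
          have := e2 i.rev
          rw [Fin.rev_rev] at this
          linear_combination this
end

section
/- Let A be an m×m nonnegative bisymmetric real matrix whose eigenvalues (with multiplicity) are α1 ≥ α2 ≥ ... ≥ αm, and let u1 be a unit nonnegative eigenvector of A corresponding to α1 with Ju1 = u1. Let B be an n×n nonnegative bisymmetric real matrix whose eigenvalues (with multiplicity) are β1 ≥ β2 ≥ ... ≥ βn, and let v1 be a unit nonnegative eigenvector of B corresponding to β1 with Jv1 = v1. Let ρ, ξ ≥ 0 and let γ1, γ2, γ3 be the eigenvalues (with multiplicity) of the 3×3 matrix Ĉ = [[β1, ρ, ξ],[ρ, α1, ρ],[ξ, ρ, β1]]. Then the (2n+m)×(2n+m) block matrix C = [[B, ρ·v1·u1ᵀ, ξ·v1·v1ᵀ],[ρ·u1·v1ᵀ, A, ρ·u1·v1ᵀ],[ξ·v1·v1ᵀ, ρ·v1·u1ᵀ,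 B]] is nonnegative and bisymmetric, and its eigenvalues (with multiplicity) are γ1, γ2, γ3, α2, α3, ..., αm, β2, β3, ..., βn, β2, β3, ..., βn (each βj with j ≥ 2 appearing twice). -/
open Matrix Polynomial BigOperators

theorem glue_charpoly {ι κ : Type*} [Fintype ι] [DecidableEq ι] [Fintype κ] [DecidableEq κ]
    (D : Matrix ι ι ℝ) (L : Matrix κ κ ℝ) (P : Matrix ι κ ℝ) (Q : Matrix κ ι ℝ)
    (h : D * P = P * L) :
    (D + P * Q).charpoly * L.charpoly = D.charpoly * (L + Q * P).charpoly := by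
  let f : ℝ →+* ℝ[X] := Polynomial.C
  have key : Matrix.fromBlocks D.charmatrix (P.map f) (Q.map f) 1 *
      Matrix.fromBlocks 1 (P.map f) 0 (-L.charmatrix) =
      Matrix.fromBlocks D.charmatrix 0 (Q.map f) (-(L + Q * P).charmatrix) := by
    rw [Matrix.fromBlocks_multiply]
    have h' : D.map f * P.map f = P.map f * L.map f := by
      rw [← Matrix.map_mul, ← Matrix.map_mul, h]
    have h1 : D.charmatrix * P.map f + P.map f * -L.charmatrix = 0 := by
      simp only [Matrix.charmatrix, RingHom.mapMatrix_apply]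
      rw [Matrix.sub_mul, Matrix.mul_neg, Matrix.mul_sub]
      change _ - D.map f * P.map f + -(_ - P.map f * L.map f) = 0
      rw [h']
      simp [Matrix.scalar_apply, ← Matrix.smul_one_eq_diagonal]
    have h2 : Q.map f * P.map f + 1 * -L.charmatrix = -(L + Q * P).charmatrix := by
      simp only [Matrix.charmatrix, RingHom.mapMatrix_apply]
      rw [← Matrix.map_mul, Matrix.map_add _ (fun a b => map_add _ a b), Matrix.one_mul]
      change _ = -(_ - (_ + (Q * P).map f))
      abel
    rw [h1, h2]
    simp
  have hd := congrArg Matrix.det key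
  rw [Matrix.det_mul, Matrix.det_fromBlocks_one₂₂, Matrix.det_fromBlocks_zero₂₁,
    Matrix.det_fromBlocks_zero₁₂, Matrix.det_one, one_mul, Matrix.det_neg, Matrix.det_neg] at hd
  have h3 : D.charmatrix - P.map f * Q.map f = (D + P * Q).charmatrix := by
    simp only [Matrix.charmatrix, RingHom.mapMatrix_apply]
    rw [← Matrix.map_mul, Matrix.map_add _ (fun a b => map_add _ a b)]
    change _ - (P * Q).map f = _ - (_ + (P * Q).map f)
    abel
  rw [h3] at hd
  have hu : ((-1 : ℝ[X]) ^ Fintype.card κ) ≠ 0 := pow_ne_zero _ (by simp)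
  apply mul_left_cancel₀ hu
  simp only [Matrix.charpoly]
  linear_combination hd

theorem revId_mul_mul (n : ℕ) (Q : Matrix (Fin n) (Fin n) ℝ) (i j : Fin n) :
    (revId n * Q * revId n) i j = Q i.rev j.rev := by
  have h1 : ∀ a b : Fin n, revId n a b = if b = a.rev then 1 else 0 := by
    intro a b
    simp only [revId, Matrix.of_apply]
    congr 1
    rw [Fin.ext_iff, Fin.val_rev, eq_iff_iff]
    omega
  have h2 : ∀ a b : Fin n, revId n a b = if a = b.rev then 1 else 0 := by
    intro a b
    rw [h1]; congr 1
    rw [eq_iff_iff]; constructor <;> (rintro rfl; simp)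
  rw [Matrix.mul_apply, Finset.sum_eq_single j.rev, Matrix.mul_apply,
    Finset.sum_eq_single i.rev]
  · rw [h1, h2]; simp
  · intro b _ hb; rw [h1]; simp [hb]
  · simp
  · intro b _ hb; rw [h2 b]; simp [hb]
  · simp

theorem revId_mulVec (n : ℕ) (v : Fin n → ℝ) (h : (revId n).mulVec v = v) (i : Fin n) :
    v i.rev = v i := by
  conv_rhs => rw [← h]
  rw [Matrix.mulVec, dotProduct, Finset.sum_eq_single i.rev]
  · simp only [revId, Matrix.of_apply]
    rw [if_pos, one_mul]
    rw [Fin.val_rev]; omega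
  · intro b _ hb
    simp only [revId, Matrix.of_apply]
    rw [if_neg, zero_mul]
    intro h; apply hb; rw [Fin.ext_iff, Fin.val_rev]; omega
  · simp

theorem prod_split (n : ℕ) (hn : 0 < n) (β : Fin n → ℝ) :
    ∏ i, (X - Polynomial.C (β i)) = (X - Polynomial.C (β ⟨0, hn⟩)) *
      ((((Finset.univ.filter fun j : Fin n => 0 < (j : ℕ)).val.map β).map
        fun a => X - Polynomial.C a).prod) := by
  rw [Multiset.map_map, ← Finset.mul_prod_erase _ _ (Finset.mem_univ (⟨0, hn⟩ : Fin n))]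
  congr 1
  have : Finset.univ.erase (⟨0, hn⟩ : Fin n) = Finset.univ.filter fun j : Fin n => 0 < (j : ℕ) := by
    ext j; simp [Fin.ext_iff, Nat.pos_iff_ne_zero]
  rw [this]; rfl

/-- Lemma 2.3: given nonnegative bisymmetric `A` (with eigenvalues `α`, unit nonnegative
`J`-symmetric Perron eigenvector `u₁`) and `B` (with eigenvalues `β`, unit nonnegative
`J`-symmetric Perron eigenvector `v₁`), and `ρ, ξ ≥ 0`, if `γ₁, γ₂, γ₃` are the eigenvalues
of `Ĉ = [[β₁, ρ, ξ], [ρ, α₁, ρ], [ξ, ρ, β₁]]`, then the block matrix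
`C = [[B, ρ v₁u₁ᵀ, ξ v₁v₁ᵀ], [ρ u₁v₁ᵀ, A, ρ u₁v₁ᵀ], [ξ v₁v₁ᵀ, ρ v₁u₁ᵀ, B]]` is nonnegative
bisymmetric with eigenvalues `γ₁, γ₂, γ₃, α₂, …, α_m, β₂, …, β_n, β₂, …, β_n`. -/
theorem bisymm_glue_lemma (m n : ℕ) (hm : 0 < m) (hn : 0 < n)
    (A : Matrix (Fin m) (Fin m) ℝ) (B : Matrix (Fin n) (Fin n) ℝ)
    (α : Fin m → ℝ) (β : Fin n → ℝ) (hα : Antitone α) (hβ : Antitone β)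
    (hAnn : MatNonneg A) (hAbs : IsBisymm A) (hAeig : HasEigs A α)
    (hBnn : MatNonneg B) (hBbs : IsBisymm B) (hBeig : HasEigs B β)
    (u1 : Fin m → ℝ) (hu1unit : ∑ i, u1 i ^ 2 = 1) (hu1nn : ∀ i, 0 ≤ u1 i)
    (hu1eig : A.mulVec u1 = α ⟨0, hm⟩ • u1) (hu1J : (revId m).mulVec u1 = u1)
    (v1 : Fin n → ℝ) (hv1unit : ∑ i, v1 i ^ 2 = 1) (hv1nn : ∀ i, 0 ≤ v1 i)
    (hv1eig : B.mulVec v1 = β ⟨0, hn⟩ • v1) (hv1J : (revId n).mulVec v1 = v1)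
    (ρ ξ : ℝ) (hρ : 0 ≤ ρ) (hξ : 0 ≤ ξ)
    (γ1 γ2 γ3 : ℝ)
    (hγ : HasEigsM !![β ⟨0, hn⟩, ρ, ξ; ρ, α ⟨0, hm⟩, ρ; ξ, ρ, β ⟨0, hn⟩]
      (γ1 ::ₘ γ2 ::ₘ {γ3}))
    (Cbig : Matrix (Fin (n + (m + n))) (Fin (n + (m + n))) ℝ)
    (hCbig : Cbig = (Matrix.reindex
        ((Equiv.sumCongr (Equiv.refl (Fin n)) finSumFinEquiv).trans finSumFinEquiv)
        ((Equiv.sumCongr (Equiv.refl (Fin n)) finSumFinEquiv).trans finSumFinEquiv))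
      (Matrix.fromBlocks B
        (Matrix.fromCols (ρ • Matrix.vecMulVec v1 u1) (ξ • Matrix.vecMulVec v1 v1))
        (Matrix.fromRows (ρ • Matrix.vecMulVec u1 v1) (ξ • Matrix.vecMulVec v1 v1))
        (Matrix.fromBlocks A (ρ • Matrix.vecMulVec u1 v1)
          (ρ • Matrix.vecMulVec v1 u1) B))) :
    MatNonneg Cbig ∧ IsBisymm Cbig ∧
      HasEigsM Cbig (γ1 ::ₘ γ2 ::ₘ γ3 ::ₘ
        (((Finset.univ.filter fun i : Fin m => 0 < (i : ℕ)).val.map α)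
          + ((Finset.univ.filter fun j : Fin n => 0 < (j : ℕ)).val.map β)
          + ((Finset.univ.filter fun j : Fin n => 0 < (j : ℕ)).val.map β))) := by
  have hA : ∀ i j, A i.rev j.rev = A i j := fun i j => by rw [← revId_mul_mul m A, hAbs.2]
  have hB : ∀ i j, B i.rev j.rev = B i j := fun i j => by rw [← revId_mul_mul n B, hBbs.2]
  have hAs : ∀ i j, A i j = A j i := fun i j => congrFun (congrFun hAbs.1 j) i
  have hBs : ∀ i j, B i j = B j i := fun i j => congrFun (congrFun hBbs.1 j) i
  have hu := revId_mulVec m u1 hu1J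
  have hv := revId_mulVec n v1 hv1J
  set M := (Matrix.fromBlocks B
        (Matrix.fromCols (ρ • Matrix.vecMulVec v1 u1) (ξ • Matrix.vecMulVec v1 v1))
        (Matrix.fromRows (ρ • Matrix.vecMulVec u1 v1) (ξ • Matrix.vecMulVec v1 v1))
        (Matrix.fromBlocks A (ρ • Matrix.vecMulVec u1 v1)
          (ρ • Matrix.vecMulVec v1 u1) B)) with hM
  set e := ((Equiv.sumCongr (Equiv.refl (Fin n)) (finSumFinEquiv (m := m) (n := n))).trans
    finSumFinEquiv) with he
  have hC : ∀ i j, Cbig (e i) (e j) = M i j := by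
    intro i j; rw [hCbig]; simp
  have hr1 : ∀ i : Fin n, (e (Sum.inl i)).rev = e (Sum.inr (Sum.inr i.rev)) := by
    intro i; ext; simp [he, Fin.val_rev]; omega
  have hr2 : ∀ i : Fin m, (e (Sum.inr (Sum.inl i))).rev = e (Sum.inr (Sum.inl i.rev)) := by
    intro i; ext; simp [he, Fin.val_rev]; omega
  have hr3 : ∀ i : Fin n, (e (Sum.inr (Sum.inr i))).rev = e (Sum.inl i.rev) := by
    intro i; ext; simp [he, Fin.val_rev]; omega
  refine ⟨?_, ⟨?_, ?_⟩, ?_⟩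
  · intro i j
    obtain ⟨i, rfl⟩ := e.surjective i
    obtain ⟨j, rfl⟩ := e.surjective j
    rw [hC]
    rcases i with i | i | i <;> rcases j with j | j | j <;>
      simp [hM, Matrix.vecMulVec_apply]
    all_goals first
      | exact hAnn _ _
      | exact hBnn _ _
      | (have := hu1nn; have := hv1nn; apply mul_nonneg (by assumption); apply mul_nonneg <;> apply_assumption)
  · ext i j
    obtain ⟨i, rfl⟩ := e.surjective i
    obtain ⟨j, rfl⟩ := e.surjective j
    rw [Matrix.transpose_apply, hC, hC]
    rcases i with i | i | i <;> rcases j with j | j | j <;>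
      simp [hM, Matrix.vecMulVec_apply]
    all_goals first
      | exact hAs _ _
      | exact hBs _ _
      | exact mul_comm _ _
      | exact Or.inl (mul_comm _ _)
  · ext i j
    rw [revId_mul_mul]
    obtain ⟨i, rfl⟩ := e.surjective i
    obtain ⟨j, rfl⟩ := e.surjective j
    rcases i with i | i | i <;> rcases j with j | j | j <;>
      simp only [hr1, hr2, hr3, hC] <;>
      simp [hM, Matrix.vecMulVec_apply, hA, hB, hu, hv]
  · have hcp : Cbig.charpoly = M.charpoly := by
      rw [hCbig, Matrix.charpoly_reindex]
    let D : Matrix (Fin n ⊕ (Fin m ⊕ Fin n)) (Fin n ⊕ (Fin m ⊕ Fin n)) ℝ :=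
      Matrix.fromBlocks B 0 0 (Matrix.fromBlocks A 0 0 B)
    let P : Matrix (Fin n ⊕ (Fin m ⊕ Fin n)) (Fin 3) ℝ :=
      Matrix.of (Sum.elim (fun a => ![v1 a, 0, 0])
        (Sum.elim (fun a => ![0, u1 a, 0]) (fun a => ![0, 0, v1 a])))
    let K : Matrix (Fin 3) (Fin 3) ℝ := !![0, ρ, ξ; ρ, 0, ρ; ξ, ρ, 0]
    let L : Matrix (Fin 3) (Fin 3) ℝ :=
      Matrix.diagonal ![β ⟨0, hn⟩, α ⟨0, hm⟩, β ⟨0, hn⟩]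
    have hue : ∀ i, ∑ j, A i j * u1 j = u1 i * α ⟨0, hm⟩ := by
      intro i; have := congrFun hu1eig i
      simp only [Matrix.mulVec, dotProduct, Pi.smul_apply, smul_eq_mul] at this
      rw [this, mul_comm]
    have hve : ∀ i, ∑ j, B i j * v1 j = v1 i * β ⟨0, hn⟩ := by
      intro i; have := congrFun hv1eig i
      simp only [Matrix.mulVec, dotProduct, Pi.smul_apply, smul_eq_mul] at this
      rw [this, mul_comm]
    have hDP : D * P = P * L := by
      ext i k
      rw [Matrix.mul_diagonal, Matrix.mul_apply]
      rcases i with i | i | i <;> fin_cases k <;>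
        simp [D, P, Fintype.sum_sum_type, hue, hve]
    have hPP : Pᵀ * P = 1 := by
      ext i k
      rw [Matrix.mul_apply]
      fin_cases i <;> fin_cases k <;>
        simp [P, Fintype.sum_sum_type, ← pow_two, hu1unit, hv1unit]
    have hMD : M = D + P * (K * Pᵀ) := by
      ext i j
      rw [Matrix.add_apply]
      simp only [Matrix.mul_apply, Fin.sum_univ_three]
      rcases i with i | i | i <;> rcases j with j | j | j <;>
        simp [hM, D, P, K, Matrix.vecMulVec_apply] <;> ring
    have hLK : L + K * Pᵀ * P =
        !![β ⟨0, hn⟩, ρ, ξ; ρ, α ⟨0, hm⟩, ρ; ξ, ρ, β ⟨0, hn⟩] := by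
      rw [Matrix.mul_assoc, hPP, Matrix.mul_one]
      ext i j
      fin_cases i <;> fin_cases j <;> simp [L, K]
    have main := glue_charpoly D L P (K * Pᵀ) hDP
    rw [← hMD, hLK] at main
    unfold HasEigsM at hγ ⊢
    unfold HasEigs at hAeig hBeig
    rw [hγ] at main
    have hD : D.charpoly = B.charpoly * (A.charpoly * B.charpoly) := by
      simp only [D]
      rw [Matrix.charpoly_fromBlocks_zero₁₂, Matrix.charpoly_fromBlocks_zero₁₂]
    have hL : L.charpoly = (X - Polynomial.C (β ⟨0, hn⟩)) * (X - Polynomial.C (α ⟨0, hm⟩)) *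
        (X - Polynomial.C (β ⟨0, hn⟩)) := by
      simp only [L]
      rw [Matrix.charpoly_diagonal, Fin.prod_univ_three]; rfl
    have hL0 : L.charpoly ≠ 0 := (Matrix.charpoly_monic L).ne_zero
    rw [hcp]
    apply mul_right_cancel₀ hL0
    rw [main, hD, hL, hAeig, hBeig, prod_split n hn β, prod_split m hm α]
    simp only [Multiset.map_cons, Multiset.prod_cons, Multiset.map_add, Multiset.prod_add,
      Multiset.map_singleton, Multiset.prod_singleton]
    ring
end

section
/- Let 1 ≤ n ≤ 4 and let λ1 ≥ λ2 ≥ ... ≥ λn be real numbers satisfying λ1 ≥ |λn| and λ1 + λ2 + ... + λn ≥ 0. Then there exists an n×n nonnegative bisymmetric real matrix whose eigenvalues (with multiplicity) are λ1, λ2, ..., λn. -/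
open Matrix Polynomial BigOperators

theorem aux_eigs {n : ℕ} (Q : Matrix (Fin n) (Fin n) ℝ) (lam : Fin n → ℝ)
    (h : ∀ x : ℝ, (Matrix.scalar (Fin n) x - Q).det = ∏ i, (x - lam i)) : HasEigs Q lam := by
  unfold HasEigs
  apply Polynomial.funext
  intro x
  rw [Matrix.eval_charpoly, h x, Polynomial.eval_prod]
  simp

theorem aux_one (a : ℝ) (ha : 0 ≤ a) (lam : Fin 1 → ℝ) (h0 : lam 0 = a) :
    ∃ Q : Matrix (Fin 1) (Fin 1) ℝ, MatNonneg Q ∧ IsBisymm Q ∧ HasEigs Q lam := by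
  refine ⟨!![a], ?_, ⟨?_, ?_⟩, aux_eigs _ _ ?_⟩
  · intro i j
    fin_cases i; fin_cases j; simpa using ha
  · ext i j
    fin_cases i; fin_cases j; simp
  · ext i j
    fin_cases i; fin_cases j; simp [revId, Matrix.mul_apply]
  · intro x
    simp [h0]

theorem aux_two (a b : ℝ) (ha : |b| ≤ a) (lam : Fin 2 → ℝ) (h0 : lam 0 = a) (h1 : lam 1 = b) :
    ∃ Q : Matrix (Fin 2) (Fin 2) ℝ, MatNonneg Q ∧ IsBisymm Q ∧ HasEigs Q lam := by
  obtain ⟨h2, h3⟩ := abs_le.mp ha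
  refine ⟨!![(a+b)/2, (a-b)/2; (a-b)/2, (a+b)/2], ?_, ⟨?_, ?_⟩, aux_eigs _ _ ?_⟩
  · intro i j
    fin_cases i <;> fin_cases j <;> simp <;> linarith
  · ext i j
    fin_cases i <;> fin_cases j <;> simp
  · ext i j
    fin_cases i <;> fin_cases j <;> simp [revId, Matrix.mul_apply, Fin.sum_univ_succ]
  · intro x
    simp [Matrix.det_fin_two, Fin.prod_univ_succ, h0, h1]
    ring

theorem aux_three (a b c s d r : ℝ) (hs : |c| ≤ s) (hd : 0 ≤ d) (hr : 0 ≤ r)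
    (e1 : s + d = a + b) (e2 : s * d - 2 * r ^ 2 = a * b)
    (lam : Fin 3 → ℝ) (h0 : lam 0 = a) (h1 : lam 1 = b) (h2 : lam 2 = c) :
    ∃ Q : Matrix (Fin 3) (Fin 3) ℝ, MatNonneg Q ∧ IsBisymm Q ∧ HasEigs Q lam := by
  obtain ⟨h3, h4⟩ := abs_le.mp hs
  refine ⟨!![(s+c)/2, r, (s-c)/2; r, d, r; (s-c)/2, r, (s+c)/2], ?_, ⟨?_, ?_⟩, aux_eigs _ _ ?_⟩
  · intro i j
    fin_cases i <;> fin_cases j <;> simp <;> linarith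
  · ext i j
    fin_cases i <;> fin_cases j <;> simp
  · ext i j
    fin_cases i <;> fin_cases j <;> simp [revId, Matrix.mul_apply, Fin.sum_univ_succ]
  · intro x
    have : ∏ i, (x - lam i) = (x - a) * (x - b) * (x - c) := by
      simp [Fin.prod_univ_succ, h0, h1, h2]; ring
    rw [this]
    simp [Matrix.det_fin_three]
    linear_combination (x - c) * (e2 - x * e1)

theorem aux_four (a b c d p q r : ℝ) (hp : |d| ≤ p) (hq : |c| ≤ q) (hr : 0 ≤ r)
    (e1 : p + q = a + b) (e2 : p * q - r ^ 2 = a * b)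
    (lam : Fin 4 → ℝ) (h0 : lam 0 = a) (h1 : lam 1 = b) (h2 : lam 2 = c) (h3 : lam 3 = d) :
    ∃ Q : Matrix (Fin 4) (Fin 4) ℝ, MatNonneg Q ∧ IsBisymm Q ∧ HasEigs Q lam := by
  obtain ⟨h4, h5⟩ := abs_le.mp hp
  obtain ⟨h6, h7⟩ := abs_le.mp hq
  refine ⟨!![(p+d)/2, r/2, r/2, (p-d)/2; r/2, (q+c)/2, (q-c)/2, r/2;
    r/2, (q-c)/2, (q+c)/2, r/2; (p-d)/2, r/2, r/2, (p+d)/2], ?_, ⟨?_, ?_⟩, aux_eigs _ _ ?_⟩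
  · intro i j
    fin_cases i <;> fin_cases j <;> simp <;> linarith
  · ext i j
    fin_cases i <;> fin_cases j <;> simp
  · ext i j
    fin_cases i <;> fin_cases j <;> simp [revId, Matrix.mul_apply, Fin.sum_univ_succ]
  · intro x
    have : ∏ i, (x - lam i) = (x - a) * (x - b) * (x - c) * (x - d) := by
      rw [Fin.prod_univ_four, h0, h1, h2, h3]
    rw [this]
    have hM : Matrix.scalar (Fin 4) x - !![(p+d)/2, r/2, r/2, (p-d)/2; r/2, (q+c)/2, (q-c)/2, r/2;
        r/2, (q-c)/2, (q+c)/2, r/2; (p-d)/2, r/2, r/2, (p+d)/2] =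
        !![x-(p+d)/2, -(r/2), -(r/2), -((p-d)/2); -(r/2), x-(q+c)/2, -((q-c)/2), -(r/2);
        -(r/2), -((q-c)/2), x-(q+c)/2, -(r/2); -((p-d)/2), -(r/2), -(r/2), x-(p+d)/2] := by
      ext i j
      fin_cases i <;> fin_cases j <;> simp
    rw [hM]
    simp [Matrix.det_succ_row_zero, Fin.sum_univ_succ, Fin.succAbove]
    linear_combination (x - c) * (x - d) * (e2 - x * e1)

/-- For `1 ≤ n ≤ 4`, the necessary conditions `λ₁ ≥ |λₙ|` and `Σ λᵢ ≥ 0` are sufficient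
for the existence of an `n × n` nonnegative bisymmetric matrix with eigenvalues
`λ₁ ≥ λ₂ ≥ … ≥ λₙ`. -/
theorem bniep_small (n : ℕ) (hn1 : 1 ≤ n) (hn4 : n ≤ 4)
    (lam : Fin n → ℝ) (hanti : Antitone lam)
    (habs : |lam ⟨n - 1, by omega⟩| ≤ lam ⟨0, by omega⟩)
    (hsum : 0 ≤ ∑ i, lam i) :
    ∃ Q : Matrix (Fin n) (Fin n) ℝ, MatNonneg Q ∧ IsBisymm Q ∧ HasEigs Q lam := by
  obtain rfl | rfl | rfl | rfl : n = 1 ∨ n = 2 ∨ n = 3 ∨ n = 4 := by omega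
  · exact aux_one (lam 0) ((abs_nonneg _).trans habs) lam rfl
  · exact aux_two (lam 0) (lam 1) habs lam rfl rfl
  · have h01 : lam 1 ≤ lam 0 := hanti (by decide)
    have h12 : lam 2 ≤ lam 1 := hanti (by decide)
    change |lam 2| ≤ lam 0 at habs
    rw [Fin.sum_univ_three] at hsum
    have h0 : 0 ≤ lam 0 := (abs_nonneg _).trans habs
    by_cases h : 0 ≤ lam 1
    · exact aux_three (lam 0) (lam 1) (lam 2) (lam 0) (lam 1) 0 habs h le_rfl rfl (by ring)
        lam rfl rfl rfl
    · push Not at h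
      have hn : 0 ≤ -(lam 0 * lam 1) / 2 := by nlinarith
      refine aux_three (lam 0) (lam 1) (lam 2) (lam 0 + lam 1) 0 (Real.sqrt (-(lam 0 * lam 1) / 2))
        ?_ le_rfl (Real.sqrt_nonneg _) (by ring) ?_ lam rfl rfl rfl
      · rw [abs_le]; constructor <;> linarith
      · rw [Real.sq_sqrt hn]; ring
  · have h01 : lam 1 ≤ lam 0 := hanti (by decide)
    have h12 : lam 2 ≤ lam 1 := hanti (by decide)
    have h23 : lam 3 ≤ lam 2 := hanti (by decide)
    change |lam 3| ≤ lam 0 at habs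
    rw [Fin.sum_univ_four] at hsum
    by_cases h : |lam 2| ≤ lam 1
    · exact aux_four (lam 0) (lam 1) (lam 2) (lam 3) (lam 0) (lam 1) 0 habs h le_rfl rfl (by ring)
        lam rfl rfl rfl rfl
    · have h' : lam 1 < -lam 2 := by
        by_contra hc
        exact h (abs_le.mpr ⟨by linarith, h12⟩)
      have h2 : lam 2 < 0 := by linarith
      have h3 : -lam 0 ≤ lam 3 := (abs_le.mp habs).1
      have hn : 0 ≤ (-lam 2 - lam 1) * (lam 0 + lam 2) :=
        mul_nonneg (by linarith) (by linarith)
      refine aux_four (lam 0) (lam 1) (lam 2) (lam 3) (lam 0 + lam 1 + lam 2) (-lam 2)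
        (Real.sqrt ((-lam 2 - lam 1) * (lam 0 + lam 2)))
        ?_ ?_ (Real.sqrt_nonneg _) (by ring) ?_ lam rfl rfl rfl rfl
      · rw [abs_le]; constructor <;> linarith
      · rw [abs_of_neg h2]
      · rw [Real.sq_sqrt hn]; ring
end

section
/- There exists a 6×6 nonnegative symmetric real matrix whose eigenvalues (with multiplicity) are 6, 6, −2, −3, −3, −4, but there exists no 6×6 nonnegative bisymmetric real matrix whose eigenvalues (with multiplicity) are 6, 6, −2, −3, −3, −4. In particular, for n = 6 the symmetric nonnegative inverse eigenvalue problem and the bisymmetric nonnegative inverse eigenvalue problem are different. -/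
open Matrix Polynomial BigOperators

/-- Characteristic polynomial of a symmetric `3 × 3` matrix. -/
lemma sym3_charpoly (a b c d e f : ℝ) :
    (!![a, d, e; d, b, f; e, f, c] : Matrix (Fin 3) (Fin 3) ℝ).charpoly =
      X ^ 3 - C (a + b + c) * X ^ 2 + C (a * b + a * c + b * c - d ^ 2 - e ^ 2 - f ^ 2) * X
        - C (a * b * c + 2 * d * e * f - a * f ^ 2 - b * e ^ 2 - c * d ^ 2) := by
  rw [Matrix.charpoly, Matrix.det_fin_three]
  simp
  rw [show (C 2 : ℝ[X]) = 2 from rfl]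
  ring

/-- Vieta for a symmetric `3 × 3` matrix. -/
lemma sym3_vieta {a b c d e f x y z : ℝ}
    (h : (!![a, d, e; d, b, f; e, f, c] : Matrix (Fin 3) (Fin 3) ℝ).charpoly =
      (X - C x) * ((X - C y) * (X - C z))) :
    a + b + c = x + y + z ∧
    a * b + a * c + b * c - d ^ 2 - e ^ 2 - f ^ 2 = x * y + x * z + y * z ∧
    a * b * c + 2 * d * e * f - a * f ^ 2 - b * e ^ 2 - c * d ^ 2 = x * y * z := by
  rw [sym3_charpoly] at h
  have h0 := congrArg (Polynomial.eval 0) h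
  have h1 := congrArg (Polynomial.eval 1) h
  have h2 := congrArg (Polynomial.eval (-1)) h
  simp at h0 h1 h2
  refine ⟨by linarith, by linarith, by linarith⟩

/-- Similarity reduction of a block matrix `[[A, B], [B, A]]`. -/
lemma charpoly_block (A B : Matrix (Fin 3) (Fin 3) ℝ) :
    (fromBlocks A B B A).charpoly = (A + B).charpoly * (A - B).charpoly := by
  rw [← Matrix.charpoly_fromBlocks_zero₂₁ (M₁₁ := A + B) (M₁₂ := B) (M₂₂ := A - B)]
  have h1 : fromBlocks (A + B) B 0 (A - B) =
      fromBlocks 1 0 (-1) 1 * (fromBlocks A B B A * fromBlocks 1 0 1 1) := by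
    simp only [Matrix.fromBlocks_multiply]
    congr 1 <;> simp <;> abel
  have h2 : fromBlocks A B B A =
      (fromBlocks A B B A * fromBlocks 1 0 1 1) * fromBlocks 1 0 (-1) 1 := by
    simp only [Matrix.fromBlocks_multiply]
    congr 1 <;> simp
  rw [h1, Matrix.charpoly_mul_comm, ← h2]

/-- Two nonnegative-cofactor argument: the double eigenvalue `6` cannot sit in the `A + B` part. -/
lemma no_double {k1 k2 k3 p q r : ℝ} (h1 : 0 < k1) (h2 : 0 < k2) (h3 : 0 < k3)
    (hp : 0 ≤ p) (hq : 0 ≤ q) (hr : 0 ≤ r)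
    (e2 : k1 * k2 + k1 * k3 + k2 * k3 - p ^ 2 - q ^ 2 - r ^ 2 = 0)
    (e3 : k1 * k2 * k3 - 2 * p * q * r - k1 * r ^ 2 - k2 * q ^ 2 - k3 * p ^ 2 = 0) : False := by
  have key : (k1 * k2 - p ^ 2) ^ 2 + (k1 * k3 - q ^ 2) ^ 2 + (k2 * k3 - r ^ 2) ^ 2
      + 2 * (k1 * r + p * q) ^ 2 + 2 * (k2 * q + p * r) ^ 2 + 2 * (k3 * p + q * r) ^ 2 = 0 := by
    linear_combination (k1 * k2 + k1 * k3 + k2 * k3 - p ^ 2 - q ^ 2 - r ^ 2) * e2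
      - 2 * (k1 + k2 + k3) * e3
  have a1 : k1 * k2 - p ^ 2 = 0 := by
    apply pow_eq_zero_iff (two_ne_zero) |>.1
    apply le_antisymm _ (sq_nonneg _)
    nlinarith [sq_nonneg (k1 * k3 - q ^ 2), sq_nonneg (k2 * k3 - r ^ 2),
      sq_nonneg (k1 * r + p * q), sq_nonneg (k2 * q + p * r), sq_nonneg (k3 * p + q * r)]
  have a2 : k3 * p + q * r = 0 := by
    apply pow_eq_zero_iff (two_ne_zero) |>.1
    apply le_antisymm _ (sq_nonneg _)
    nlinarith [sq_nonneg (k1 * k3 - q ^ 2), sq_nonneg (k2 * k3 - r ^ 2),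
      sq_nonneg (k1 * r + p * q), sq_nonneg (k2 * q + p * r), sq_nonneg (k1 * k2 - p ^ 2)]
  have hp0 : p = 0 := by
    have : k3 * p = 0 := by nlinarith [mul_nonneg hq hr, mul_nonneg h3.le hp]
    rcases mul_eq_zero.1 this with h | h
    · linarith
    · exact h
  subst hp0
  nlinarith [mul_pos h1 h2]

/-- The arithmetic core. -/
lemma core {a1 a2 a3 d e f b1 b2 b3 g h k x y z u v w : ℝ}
    (ha1 : 0 ≤ a1) (ha2 : 0 ≤ a2) (ha3 : 0 ≤ a3) (hd : 0 ≤ d) (he : 0 ≤ e) (hf : 0 ≤ f)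
    (hb1 : 0 ≤ b1) (hb2 : 0 ≤ b2) (hb3 : 0 ≤ b3) (hg : 0 ≤ g) (hh : 0 ≤ h) (hk : 0 ≤ k)
    (hM : (!![a1 + b1, d + g, e + h; d + g, a2 + b2, f + k; e + h, f + k, a3 + b3] :
      Matrix (Fin 3) (Fin 3) ℝ).charpoly = (X - C x) * ((X - C y) * (X - C z)))
    (hN : (!![a1 - b1, d - g, e - h; d - g, a2 - b2, f - k; e - h, f - k, a3 - b3] :
      Matrix (Fin 3) (Fin 3) ℝ).charpoly = (X - C u) * ((X - C v) * (X - C w)))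
    (hsum : x + y + z + (u + v + w) = 0) :
    0 ≤ x + y + z ∧ u ^ 2 + v ^ 2 + w ^ 2 ≤ x ^ 2 + y ^ 2 + z ^ 2 ∧
    (x + y + z = 0 → u * v * w ≤ x * y * z) ∧
    (x = 6 → y = 6 → u ^ 2 + v ^ 2 + w ^ 2 < 36 → False) := by
  obtain ⟨m1, m2, m3⟩ := sym3_vieta hM
  obtain ⟨n1, n2, n3⟩ := sym3_vieta hN
  have z1 : a1 = 0 := by linarith
  have z2 : a2 = 0 := by linarith
  have z3 : a3 = 0 := by linarith
  subst z1 z2 z3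
  have sM : x ^ 2 + y ^ 2 + z ^ 2 = b1 ^ 2 + b2 ^ 2 + b3 ^ 2
      + 2 * ((d + g) ^ 2 + (e + h) ^ 2 + (f + k) ^ 2) := by
    have : (0 + b1 + (0 + b2) + (0 + b3)) ^ 2 = (x + y + z) ^ 2 := by rw [m1]
    linarith
  have sN : u ^ 2 + v ^ 2 + w ^ 2 = b1 ^ 2 + b2 ^ 2 + b3 ^ 2
      + 2 * ((d - g) ^ 2 + (e - h) ^ 2 + (f - k) ^ 2) := by
    have : (0 - b1 + (0 - b2) + (0 - b3)) ^ 2 = (u + v + w) ^ 2 := by rw [n1]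
    linarith
  refine ⟨by linarith, ?_, ?_, ?_⟩
  · nlinarith [mul_nonneg hd hg, mul_nonneg he hh, mul_nonneg hf hk]
  · intro h0
    have z1 : b1 = 0 := by linarith
    have z2 : b2 = 0 := by linarith
    have z3 : b3 = 0 := by linarith
    subst z1 z2 z3
    have := mul_nonneg (mul_nonneg hd he) hk
    have := mul_nonneg (mul_nonneg hd hh) hf
    have := mul_nonneg (mul_nonneg hg he) hf
    have := mul_nonneg (mul_nonneg hg hh) hk
    linarith
  · intro hx hy hlt
    subst hx hy
    have c1 : b1 < 6 := by
      apply lt_of_pow_lt_pow_left₀ 2 (by norm_num)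
      linarith [sq_nonneg b2, sq_nonneg b3, sq_nonneg (d - g), sq_nonneg (e - h), sq_nonneg (f - k)]
    have c2 : b2 < 6 := by
      apply lt_of_pow_lt_pow_left₀ 2 (by norm_num)
      linarith [sq_nonneg b1, sq_nonneg b3, sq_nonneg (d - g), sq_nonneg (e - h), sq_nonneg (f - k)]
    have c3 : b3 < 6 := by
      apply lt_of_pow_lt_pow_left₀ 2 (by norm_num)
      linarith [sq_nonneg b1, sq_nonneg b2, sq_nonneg (d - g), sq_nonneg (e - h), sq_nonneg (f - k)]
    refine no_double (k1 := 6 - b1) (k2 := 6 - b2) (k3 := 6 - b3)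
      (by linarith) (by linarith) (by linarith)
      (add_nonneg hd hg) (add_nonneg he hh) (add_nonneg hf hk) ?_ ?_
    · linear_combination m2 - 12 * m1
    · linear_combination -36 * m1 + 6 * m2 - m3

/-- The ten ways to split the spectrum in two triples. -/
lemma split_cases {p q : ℝ[X]} (hp : p.Monic) (hq : q.Monic) (hpd : p.natDegree = 3)
    (h : p * q = ∏ i, (X - Polynomial.C ((![6, 6, -2, -3, -3, -4] : Fin 6 → ℝ) i))) :
    ∃ S T : Multiset ℤ, S + T = {6, 6, -2, -3, -3, -4} ∧ Multiset.card S = 3 ∧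
      p = ((S.map (fun n : ℤ => (n : ℝ))).map fun a => X - C a).prod ∧
      q = ((T.map (fun n : ℤ => (n : ℝ))).map fun a => X - C a).prod := by
  have hP : p * q = ((({6, 6, -2, -3, -3, -4} : Multiset ℤ).map (fun n : ℤ => (n : ℝ))).map
      fun a => X - C a).prod := by
    rw [h, Fin.prod_univ_six]; simp [mul_assoc]
  have hroots : p.roots + q.roots =
      ({6, 6, -2, -3, -3, -4} : Multiset ℤ).map (fun n : ℤ => (n : ℝ)) := by
    rw [← Polynomial.roots_mul (hp.mul hq).ne_zero, hP, Polynomial.roots_multiset_prod_X_sub_C]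
  have hsp : (p * q).Splits := by
    rw [hP]
    apply Polynomial.Splits.multisetProd
    intro f hf
    obtain ⟨a, -, rfl⟩ := Multiset.mem_map.1 hf
    exact Polynomial.Splits.X_sub_C a
  have hps : p.Splits := hsp.of_dvd (hp.mul hq).ne_zero (dvd_mul_right _ _)
  have hqs : q.Splits := hsp.of_dvd (hp.mul hq).ne_zero (dvd_mul_left _ _)
  have hlift : ∀ R : Multiset ℝ, R ≤ p.roots + q.roots →
      (R.map Int.floor).map (fun n : ℤ => (n : ℝ)) = R := by
    intro R hR
    rw [Multiset.map_map]
    conv_rhs => rw [← Multiset.map_id R]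
    refine Multiset.map_congr rfl fun a ha => ?_
    have ha' := Multiset.mem_of_le hR ha
    rw [hroots] at ha'
    obtain ⟨n, -, rfl⟩ := Multiset.mem_map.1 ha'
    simp
  have hS := hlift p.roots (Multiset.le_add_right _ _)
  have hT := hlift q.roots (Multiset.le_add_left _ _)
  have hST : ({6, 6, -2, -3, -3, -4} : Multiset ℤ) =
      p.roots.map Int.floor + q.roots.map Int.floor := by
    rw [← Multiset.map_add, hroots, Multiset.map_map]
    conv_lhs => rw [← Multiset.map_id ({6, 6, -2, -3, -3, -4} : Multiset ℤ)]
    refine Multiset.map_congr rfl fun a _ => ?_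
    simp
  generalize p.roots.map Int.floor = S at *
  generalize q.roots.map Int.floor = T at *
  refine ⟨S, T, hST.symm, ?_, ?_, ?_⟩
  · rw [← hpd, hps.natDegree_eq_card_roots, ← hS, Multiset.card_map]
  · rw [hS]; exact hps.eq_prod_roots_of_monic hp
  · rw [hT]; exact hqs.eq_prod_roots_of_monic hq

lemma enum_cases : ∀ S ∈ Multiset.powersetCard 3 ({6, 6, -2, -3, -3, -4} : Multiset ℤ),
    ∃ l ∈ ([((6, 6, -2), (-3, -3, -4)), ((6, 6, -3), (-2, -3, -4)), ((6, 6, -4), (-2, -3, -3)),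
      ((6, -2, -3), (6, -3, -4)), ((6, -2, -4), (6, -3, -3)), ((6, -3, -3), (6, -2, -4)),
      ((6, -3, -4), (6, -2, -3)), ((-2, -3, -3), (6, 6, -4)), ((-2, -3, -4), (6, 6, -3)),
      ((-3, -3, -4), (6, 6, -2))] : List ((ℤ × ℤ × ℤ) × (ℤ × ℤ × ℤ))),
      S = {l.1.1, l.1.2.1, l.1.2.2} ∧
      ({6, 6, -2, -3, -3, -4} : Multiset ℤ) - S = {l.2.1, l.2.2.1, l.2.2.2} := by
  decide

/-- For `n = 6` the SNIEP and the BNIEP are different: there is a `6 × 6` nonnegative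
symmetric matrix with eigenvalues `6, 6, -2, -3, -3, -4`, but no `6 × 6` nonnegative
bisymmetric matrix with these eigenvalues. -/
theorem sniep_ne_bniep_six :
    (∃ Q : Matrix (Fin 6) (Fin 6) ℝ, MatNonneg Q ∧ Qᵀ = Q ∧
      HasEigs Q ![6, 6, -2, -3, -3, -4]) ∧
    ¬ (∃ Q : Matrix (Fin 6) (Fin 6) ℝ, MatNonneg Q ∧ IsBisymm Q ∧
      HasEigs Q ![6, 6, -2, -3, -3, -4]) := by
  constructor
  · set s := √(6 : ℝ) with hs
    have hs2 : s ^ 2 = 6 := Real.sq_sqrt (by norm_num)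
    have hs0 : 0 ≤ s := Real.sqrt_nonneg _
    let A : Matrix (Fin 3) (Fin 3) ℝ := !![0, s, s; s, 0, 4; s, 4, 0]
    let B : Matrix (Fin 3) (Fin 3) ℝ := !![0, 3, 3; 3, 0, 3; 3, 3, 0]
    have hA : ∀ i j, 0 ≤ A i j := by
      intro i j; fin_cases i <;> fin_cases j <;> simp [A, hs0]
    have hB : ∀ i j, 0 ≤ B i j := by
      intro i j; fin_cases i <;> fin_cases j <;> simp [B]
    have hAt : Aᵀ = A := by
      ext i j; fin_cases i <;> fin_cases j <;> simp [A]
    have hBt : Bᵀ = B := by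
      ext i j; fin_cases i <;> fin_cases j <;> simp [B]
    refine ⟨Matrix.reindex finSumFinEquiv finSumFinEquiv (fromBlocks A 0 0 B), ?_, ?_, ?_⟩
    · intro i j
      simp only [Matrix.reindex_apply, Matrix.submatrix_apply]
      generalize (finSumFinEquiv (m := 3) (n := 3)).symm i = i'
      generalize (finSumFinEquiv (m := 3) (n := 3)).symm j = j'
      rcases i' with i | i <;> rcases j' with j | j <;> simp [hA, hB]
    · rw [Matrix.transpose_reindex, Matrix.fromBlocks_transpose, hAt, hBt]
      simp
    · unfold HasEigs
      rw [Matrix.charpoly_reindex, Matrix.charpoly_fromBlocks_zero₂₁, sym3_charpoly, sym3_charpoly]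
      have e1 : 0 * 0 + 0 * 0 + 0 * 0 - s ^ 2 - s ^ 2 - (4 : ℝ) ^ 2 = -28 := by
        rw [hs2]; norm_num
      have e2 : 0 * 0 * 0 + 2 * s * s * 4 - 0 * 4 ^ 2 - 0 * s ^ 2 - 0 * s ^ 2 = (48 : ℝ) := by
        linear_combination 8 * hs2
      rw [e1, e2]
      rw [Fin.prod_univ_six]
      simp
      norm_num
      simp only [map_ofNat]
      ring
  · rintro ⟨Q, hQ, ⟨hsym, hJ⟩, hE⟩
    have hs : ∀ i j, Q i j = Q j i := fun i j => congrFun (congrFun hsym.symm i) j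
    have hr : ∀ i j, Q i j = Q (Fin.rev i) (Fin.rev j) := by
      have hR : revId 6 = (Fin.revPerm.toPEquiv.toMatrix : Matrix (Fin 6) (Fin 6) ℝ) := by
        ext i j
        fin_cases i <;> fin_cases j <;> simp [revId, PEquiv.toMatrix_apply] <;> decide
      intro i j
      conv_lhs => rw [← hJ, hR]
      rw [PEquiv.toMatrix_toPEquiv_mul, PEquiv.mul_toMatrix_toPEquiv]
      simp
    let A : Matrix (Fin 3) (Fin 3) ℝ :=
      !![Q 0 0, Q 0 1, Q 0 2; Q 0 1, Q 1 1, Q 1 2; Q 0 2, Q 1 2, Q 2 2]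
    let B : Matrix (Fin 3) (Fin 3) ℝ :=
      !![Q 0 5, Q 0 4, Q 0 3; Q 0 4, Q 1 4, Q 1 3; Q 0 3, Q 1 3, Q 2 3]
    let e : Fin 3 ⊕ Fin 3 ≃ Fin 6 :=
      { toFun := Sum.elim ![0, 1, 2] ![5, 4, 3]
        invFun := ![Sum.inl 0, Sum.inl 1, Sum.inl 2, Sum.inr 2, Sum.inr 1, Sum.inr 0]
        left_inv := by decide
        right_inv := by decide }
    have hre : Matrix.reindex e.symm e.symm Q = fromBlocks A B B A := by
      have r1 := hr 5 5
      have r2 := hr 5 4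
      have r3 := hr 5 3
      have r4 := hr 4 4
      have r5 := hr 4 3
      have r6 := hr 3 3
      have r7 := hr 1 5
      have r8 := hr 2 5
      have r9 := hr 2 4
      have s1 := hs 1 0
      have s2 := hs 2 0
      have s3 := hs 2 1
      have t1 := hs 5 0
      have t2 := hs 4 0
      have t3 := hs 3 0
      have t4 := hs 4 1
      have t5 := hs 3 1
      have t6 := hs 3 2
      have t7 := hs 5 1
      have t8 := hs 5 2
      have t9 := hs 4 2
      have u1 := hs 4 5
      have u2 := hs 3 5
      have u3 := hs 3 4
      simp only [show Fin.rev (0 : Fin 6) = 5 from rfl, show Fin.rev (1 : Fin 6) = 4 from rfl,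
        show Fin.rev (2 : Fin 6) = 3 from rfl, show Fin.rev (3 : Fin 6) = 2 from rfl,
        show Fin.rev (4 : Fin 6) = 1 from rfl, show Fin.rev (5 : Fin 6) = 0 from rfl] at *
      ext i j
      rcases i with i | i <;> rcases j with j | j <;> fin_cases i <;> fin_cases j <;>
        simp [e, A, B] <;> linarith
    have hprod := charpoly_block A B
    rw [← hre, Matrix.charpoly_reindex] at hprod
    obtain ⟨S, T, hST, hS3, hp, hq⟩ := split_cases (Matrix.charpoly_monic (A + B))
      (Matrix.charpoly_monic (A - B)) (by rw [Matrix.charpoly_natDegree_eq_dim]; simp)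
      (hprod.symm.trans hE)
    obtain ⟨⟨⟨x, y, z⟩, ⟨u, v, w⟩⟩, hl, h1, h2⟩ := enum_cases S (Multiset.mem_powersetCard.2
      ⟨hST ▸ Multiset.le_add_right _ _, hS3⟩)
    rw [← hST, add_tsub_cancel_left] at h2
    dsimp only at h1 h2
    rw [h1] at hp
    rw [h2] at hq
    have hAB : A + B = !![Q 0 0 + Q 0 5, Q 0 1 + Q 0 4, Q 0 2 + Q 0 3;
        Q 0 1 + Q 0 4, Q 1 1 + Q 1 4, Q 1 2 + Q 1 3;
        Q 0 2 + Q 0 3, Q 1 2 + Q 1 3, Q 2 2 + Q 2 3] := by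
      ext i j; fin_cases i <;> fin_cases j <;> simp [A, B]
    have hAB' : A - B = !![Q 0 0 - Q 0 5, Q 0 1 - Q 0 4, Q 0 2 - Q 0 3;
        Q 0 1 - Q 0 4, Q 1 1 - Q 1 4, Q 1 2 - Q 1 3;
        Q 0 2 - Q 0 3, Q 1 2 - Q 1 3, Q 2 2 - Q 2 3] := by
      ext i j; fin_cases i <;> fin_cases j <;> simp [A, B]
    rw [hAB] at hp
    rw [hAB'] at hq
    simp only [Multiset.insert_eq_cons, Multiset.map_cons, Multiset.map_singleton,
      Multiset.prod_cons, Multiset.prod_singleton] at hp hq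
    have hz : x + y + z + (u + v + w) = 0 := by
      have := congrArg Multiset.sum hST
      rw [h1, h2] at this
      simp at this
      linarith
    obtain ⟨c1, c2, c3, c4⟩ := core (hQ 0 0) (hQ 1 1) (hQ 2 2) (hQ 0 1) (hQ 0 2) (hQ 1 2)
      (hQ 0 5) (hQ 1 4) (hQ 2 3) (hQ 0 4) (hQ 0 3) (hQ 1 3) hp hq (by exact_mod_cast hz)
    clear hp hq h1 h2 hz
    simp only [List.mem_cons, List.not_mem_nil, or_false, Prod.mk.injEq] at hl
    rcases hl with h | h | h | h | h | h | h | h | h | h <;>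
      obtain ⟨⟨rfl, rfl, rfl⟩, rfl, rfl, rfl⟩ := h <;>
      first
      | (exfalso; norm_num at c1; done)
      | (exfalso; norm_num at c2; done)
      | (exfalso; norm_num at c3; done)
      | (exfalso; norm_num at c4; done)
end

section
/- Let λ0 ≥ 0 ≥ λ1 ≥ λ2 ≥ ... ≥ λn be real numbers with λ0 + λ1 + ... + λn ≥ 0. Then there exists an (n+1)×(n+1) nonnegative bisymmetric real matrix whose eigenvalues (with multiplicity) are λ0, λ1, ..., λn. -/
open Matrix Polynomial BigOperators

namespace BSul

/-- extend a vector by one entry at each end -/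
def ext2 {α : Type} {n : ℕ} (a : α) (w : Fin n → α) (b : α) : Fin (n + 2) → α :=
  Fin.cons a (Fin.snoc (α := fun _ => α) w b)

lemma cases2 {n : ℕ} {p : Fin (n + 2) → Prop} (h0 : p 0) (hl : p (Fin.last _))
    (hm : ∀ i : Fin n, p i.castSucc.succ) : ∀ i, p i := by
  intro i
  refine Fin.cases h0 (fun j => ?_) i
  refine Fin.lastCases ?_ (fun k => hm k) j
  simpa using hl

section
variable {α : Type} {n : ℕ} (a b : α) (w : Fin n → α)

@[simp] lemma ext2_zero : ext2 a w b 0 = a := rfl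
@[simp] lemma ext2_last : ext2 a w b (Fin.last _) = b := by
  rw [← Fin.succ_last]; simp [ext2]
@[simp] lemma ext2_mid (i : Fin n) : ext2 a w b i.castSucc.succ = w i := by
  simp [ext2]
lemma rev_mid (i : Fin n) : Fin.rev (i.castSucc.succ) = (Fin.rev i).castSucc.succ := by
  ext; simp [Fin.val_rev]; omega
end

lemma ext2_dot {n : ℕ} (a b c d : ℝ) (v w : Fin n → ℝ) :
    ext2 a v b ⬝ᵥ ext2 c w d = a * c + v ⬝ᵥ w + b * d := by
  simp only [dotProduct]
  rw [Fin.sum_univ_succ, Fin.sum_univ_castSucc]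
  simp only [ext2_zero, ext2_mid, Fin.succ_last, ext2_last]
  ring

def Good (n : ℕ) (l : ℝ) (mu : Fin n → ℝ) : Prop :=
  ∃ (Q : Matrix (Fin (n + 1)) (Fin (n + 1)) ℝ) (u : Fin (n + 1) → ℝ)
    (V : Fin n → Fin (n + 1) → ℝ),
    (∀ i j, 0 ≤ Q i j) ∧ (∀ i j, Q i j = Q j i) ∧ (∀ i j, Q i.rev j.rev = Q i j) ∧
    (∀ i, 0 ≤ u i) ∧ (∀ i, u i.rev = u i) ∧ u ⬝ᵥ u = 1 ∧ (∀ i, Q i ⬝ᵥ u = l * u i) ∧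
    (∀ k, u ⬝ᵥ V k = 0) ∧ (∀ k m, V k ⬝ᵥ V m = if k = m then 1 else 0) ∧
    (∀ k i, Q i ⬝ᵥ V k = mu k * V k i)

lemma two_dim (p q : ℝ) (hp : 0 ≤ p) (hq : 0 ≤ q) :
    ∃ r x y : ℝ, 0 ≤ r ∧ 0 ≤ x ∧ 0 ≤ y ∧ 2 * x ^ 2 + y ^ 2 = 1 ∧ r * y = p * x ∧
      2 * r * x = q * y := by
  by_cases h : p + q = 0
  · have h1 : p = 0 := by linarith
    have h2 : q = 0 := by linarith
    exact ⟨0, 0, 1, by simp, by simp, by simp, by simp, by simp, by simp [h2]⟩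
  · have hpos : 0 < p + q := lt_of_le_of_ne (by linarith) (Ne.symm h)
    have hP := Real.sq_sqrt hp
    have hQ := Real.sq_sqrt hq
    have hN := Real.sq_sqrt hpos.le
    have hNp : 0 < √(p + q) := Real.sqrt_pos.2 hpos
    have h2 : (√2) ^ 2 = (2 : ℝ) := Real.sq_sqrt (by norm_num)
    have h2p : 0 < √(2 : ℝ) := Real.sqrt_pos.2 (by norm_num)
    set P := √p
    set R := √q
    set N := √(p + q)
    set c := √(2 : ℝ)
    have hPn : 0 ≤ P := Real.sqrt_nonneg _
    have hRn : 0 ≤ R := Real.sqrt_nonneg _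
    refine ⟨P * R / c, R / (c * N), P / N, by positivity, by positivity, by positivity, ?_, ?_, ?_⟩
    · field_simp
      rw [h2, hN, hP, hQ]; ring
    · field_simp
      rw [hP]; ring
    · field_simp
      rw [h2, hQ]; ring

lemma good_step (n : ℕ) (l : ℝ) (mu : Fin (n + 2) → ℝ) (hl : 0 ≤ l + mu 0 + mu 1)
    (h0 : mu 0 ≤ 0) (h1 : mu 1 ≤ 0)
    (h : Good n (l + mu 0 + mu 1) fun i => mu i.succ.succ) : Good (n + 2) l mu := by
  obtain ⟨Q, u, V, hQ, hS, hR, hu, hur, huu, hQu, huV, hVV, hQV⟩ := h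
  obtain ⟨r, x, y, hr, hx, hy, hxy, hry, hrx⟩ :=
    two_dim (l + mu 1) (-(mu 0) - mu 1) (by linarith) (by linarith)
  obtain ⟨c, hc⟩ : ∃ c : ℝ, c * c = 1 / 2 :=
    ⟨√(1 / 2), Real.mul_self_sqrt (by norm_num)⟩
  set t := - mu 1 with ht
  have hdu : ∀ s : ℝ, ∀ w : Fin (n + 1) → ℝ, w ⬝ᵥ (fun i => s * u i) = s * (w ⬝ᵥ u) := by
    intro s w; simpa [Pi.smul_def] using dotProduct_smul s w u
  have hud : ∀ s : ℝ, ∀ w : Fin (n + 1) → ℝ, (fun i => s * u i) ⬝ᵥ w = s * (u ⬝ᵥ w) := by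
    intro s w; simpa [Pi.smul_def] using smul_dotProduct s u w
  have hz : ∀ w : Fin (n + 1) → ℝ, w ⬝ᵥ (fun _ => (0 : ℝ)) = 0 := by
    intro w; simp [dotProduct]
  have hz' : ∀ w : Fin (n + 1) → ℝ, (fun _ => (0 : ℝ)) ⬝ᵥ w = 0 := by
    intro w; simp [dotProduct]
  have hVu : ∀ k, V k ⬝ᵥ u = 0 := fun k => by rw [dotProduct_comm]; exact huV k
  refine ⟨ext2 (ext2 0 (fun i => r * u i) t) (fun i => ext2 (r * u i) (Q i) (r * u i))
      (ext2 t (fun i => r * u i) 0),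
    ext2 x (fun i => y * u i) x,
    Fin.cons (ext2 (c * y) (fun i => (-2 * c * x) * u i) (c * y))
      (Fin.cons (ext2 c (fun _ => 0) (-c)) (fun k => ext2 0 (V k) 0)),
    ?_, ?_, ?_, ?_, ?_, ?_, ?_, ?_, ?_, ?_⟩
  · have : ∀ i, 0 ≤ r * u i := fun i => mul_nonneg hr (hu i)
    have h' : 0 ≤ t := by linarith
    refine cases2 ?_ ?_ (fun i => ?_) <;> refine cases2 ?_ ?_ (fun j => ?_) <;> simp [*]
  · refine cases2 ?_ ?_ (fun i => ?_) <;> refine cases2 ?_ ?_ (fun j => ?_) <;> simp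
    exact hS _ _
  · refine cases2 ?_ ?_ (fun i => ?_) <;> refine cases2 ?_ ?_ (fun j => ?_) <;>
      simp [rev_mid, hur, hR]
  · refine cases2 ?_ ?_ (fun i => ?_) <;> simp [hx, mul_nonneg, hy, hu]
  · refine cases2 ?_ ?_ (fun i => ?_) <;> simp [rev_mid, hur]
  · rw [ext2_dot, hdu, hud, huu]; linarith
  · refine cases2 ?_ ?_ (fun i => ?_) <;>
      simp only [ext2_zero, ext2_last, ext2_mid, ext2_dot, hdu, hud, huu, hQu]
    · linarith
    · linarith
    · linear_combination (u i) * hrx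
  · refine Fin.cases ?_ (Fin.cases ?_ (fun k => ?_)) <;>
      simp only [Fin.cons_zero, Fin.cons_succ, ext2_dot, hdu, hud, huu, huV, hz] <;> ring
  · refine Fin.cases ?_ (Fin.cases ?_ (fun k => ?_)) <;>
    refine Fin.cases ?_ (Fin.cases ?_ (fun m => ?_)) <;>
      simp only [Fin.cons_zero, Fin.cons_succ, ext2_dot, hdu, hud, huu, huV, hVu, hz, hz', hVV,
        Fin.succ_inj]
    · simp; linear_combination (2 * y ^ 2 + 4 * x ^ 2) * hc + hxy
    · simp
    · simp [(Fin.succ_ne_zero _).symm]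
    · simp
    · simp; linarith
    · simp [(Fin.succ_ne_zero _).symm]
    · simp
    · simp
    · simp
  · refine Fin.cases ?_ (Fin.cases ?_ (fun k => ?_)) <;> refine cases2 ?_ ?_ (fun i => ?_) <;>
      simp only [Fin.cons_zero, Fin.cons_succ, ext2_zero, ext2_last, ext2_mid, ext2_dot, hdu,
        hud, huu, hQu, huV, hz, hQV]
    · linear_combination (-c) * hrx
    · linear_combination (-c) * hrx
    · linear_combination (2 * c * u i) * hry
    · simp [ht]
    · simp [ht]
    · ring
    · ring
    · ring
    · ring

lemma good_zero (l : ℝ) (hl : 0 ≤ l) (mu : Fin 0 → ℝ) : Good 0 l mu := by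
  refine ⟨fun _ _ => l, fun _ => 1, fun k => k.elim0, ?_, ?_, ?_, ?_, ?_, ?_, ?_, ?_, ?_, ?_⟩ <;>
    simp [hl, dotProduct]

lemma good_one (l : ℝ) (mu : Fin 1 → ℝ) (hmu : mu 0 ≤ 0) (hl : 0 ≤ l + mu 0) : Good 1 l mu := by
  obtain ⟨c, hc0, hc⟩ : ∃ c : ℝ, 0 ≤ c ∧ c * c = 1 / 2 :=
    ⟨√(1 / 2), Real.sqrt_nonneg _, Real.mul_self_sqrt (by norm_num)⟩
  refine ⟨!![(l + mu 0) / 2, (l - mu 0) / 2; (l - mu 0) / 2, (l + mu 0) / 2],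
    ![c, c], fun _ => ![c, -c], ?_, ?_, ?_, ?_, ?_, ?_, ?_, ?_, ?_, ?_⟩
  · intro i j; fin_cases i <;> fin_cases j <;> simp <;> linarith
  · intro i j; fin_cases i <;> fin_cases j <;> simp
  · intro i j; fin_cases i <;> fin_cases j <;> simp [Fin.rev]
  · intro i; fin_cases i <;> simp [hc0]
  · intro i; fin_cases i <;> simp [Fin.rev]
  · simp [dotProduct, Fin.sum_univ_two]; linarith
  · intro i; fin_cases i <;> simp [dotProduct, Fin.sum_univ_two] <;> ring
  · simp [dotProduct, Fin.sum_univ_two]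
  · intro k m; simp [dotProduct, Fin.sum_univ_two, Subsingleton.elim k m]; linarith
  · intro k i; rw [Subsingleton.elim k 0]
    fin_cases i <;> simp [dotProduct, Fin.sum_univ_two] <;> ring

lemma good_all : ∀ (n : ℕ) (l : ℝ) (mu : Fin n → ℝ), (∀ i, mu i ≤ 0) → 0 ≤ l + ∑ i, mu i →
    Good n l mu
  | 0, l, mu, _, h => good_zero l (by simpa using h) mu
  | 1, l, mu, hm, h => good_one l mu (hm 0) (by simpa using h)
  | n + 2, l, mu, hm, h => by
    rw [Fin.sum_univ_succ, Fin.sum_univ_succ] at h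
    have h' : ∑ i : Fin n, mu i.succ.succ ≤ 0 := Finset.sum_nonpos fun i _ => hm _
    have e : mu (Fin.succ 0) = mu 1 := rfl
    rw [e] at h
    exact good_step n l mu (by linarith) (hm 0) (hm 1)
      (good_all n _ _ (fun i => hm _) (by linarith))

lemma revId_mul {n : ℕ} (Q : Matrix (Fin n) (Fin n) ℝ) : revId n * Q * revId n =
    Matrix.of fun i j => Q i.rev j.rev := by
  have hr : ∀ i j : Fin n, revId n i j = if j = i.rev then 1 else 0 := by
    intro i j
    simp only [revId, Matrix.of_apply]
    congr 1
    rw [Fin.ext_iff, Fin.val_rev]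
    apply propext
    omega
  have hr' : ∀ i j : Fin n, revId n i j = if i = j.rev then 1 else 0 := by
    intro i j
    rw [hr]
    congr 1
    apply propext
    constructor <;> rintro rfl <;> simp
  ext i j
  rw [Matrix.mul_apply]
  simp only [hr' _ j, Matrix.mul_apply, hr i]
  simp

lemma finish (n : ℕ) (l : ℝ) (mu : Fin n → ℝ) (h : Good n l mu) :
    ∃ Q : Matrix (Fin (n + 1)) (Fin (n + 1)) ℝ,
      MatNonneg Q ∧ IsBisymm Q ∧ HasEigs Q (Fin.cons l mu) := by
  obtain ⟨Q, u, V, hQ, hS, hR, hu, hur, huu, hQu, huV, hVV, hQV⟩ := h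
  refine ⟨Q, hQ, ⟨?_, ?_⟩, ?_⟩
  · ext i j; exact hS j i
  · rw [revId_mul]; ext i j; exact hR i j
  · let W : Matrix (Fin (n + 1)) (Fin (n + 1)) ℝ := Matrix.of (Fin.cons u V)
    have w0 : W 0 = u := rfl
    have ws : ∀ k : Fin n, W k.succ = V k := fun _ => rfl
    have hW : W * Wᵀ = 1 := by
      ext i j
      have : (W * Wᵀ) i j = W i ⬝ᵥ W j := rfl
      rw [this, Matrix.one_apply]
      clear this
      revert i j
      refine Fin.cases ?_ (fun k => ?_) <;> refine Fin.cases ?_ (fun m => ?_)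
      · simpa [w0, ws] using huu
      · simpa [w0, ws, (Fin.succ_ne_zero _).symm] using huV m
      · rw [dotProduct_comm]
        simpa [w0, ws, Fin.succ_ne_zero] using huV k
      · simpa [w0, ws] using hVV k m
    have hW' : Wᵀ * W = 1 := mul_eq_one_comm.1 hW
    have hQW : Q * Wᵀ = Wᵀ * Matrix.diagonal (Fin.cons l mu) := by
      ext i j
      have : (Q * Wᵀ) i j = Q i ⬝ᵥ W j := rfl
      rw [this, Matrix.mul_diagonal, Matrix.transpose_apply]
      clear this
      revert j
      refine Fin.cases ?_ (fun m => ?_)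
      · simpa [w0, ws, mul_comm] using hQu i
      · simpa [w0, ws, mul_comm] using hQV m i
    have hc : Q = Wᵀ * Matrix.diagonal (Fin.cons l mu) * W := by
      rw [← hQW, Matrix.mul_assoc, hW', Matrix.mul_one]
    let M : (Matrix (Fin (n + 1)) (Fin (n + 1)) ℝ)ˣ := ⟨Wᵀ, W, hW', hW⟩
    have := Matrix.charpoly_units_conj M (Matrix.diagonal (Fin.cons l mu))
    rw [← Matrix.coe_units_inv] at this
    unfold HasEigs
    rw [← Matrix.charpoly_diagonal, ← this, hc]
    rfl

end BSul

/-- Suleimanova-type condition for the BNIEP: if `λ₀ ≥ 0 ≥ λ₁ ≥ … ≥ λₙ` and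
`Σ λᵢ ≥ 0`, then there is an `(n+1) × (n+1)` nonnegative bisymmetric matrix with
eigenvalues `λ₀, λ₁, …, λₙ`. -/
theorem bniep_suleimanova (n : ℕ) (lam : ℕ → ℝ)
    (h0 : 0 ≤ lam 0)
    (hneg : ∀ i, 1 ≤ i → i ≤ n → lam i ≤ 0)
    (hanti : ∀ i j, 1 ≤ i → i ≤ j → j ≤ n → lam j ≤ lam i)
    (hsum : 0 ≤ ∑ i ∈ Finset.range (n + 1), lam i) :
    ∃ Q : Matrix (Fin (n + 1)) (Fin (n + 1)) ℝ,
      MatNonneg Q ∧ IsBisymm Q ∧ HasEigs Q fun i => lam (i : ℕ) := by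
  have hs := hsum
  rw [Finset.sum_range_succ', ← Fin.sum_univ_eq_sum_range (fun i => lam (i + 1)) n] at hs
  obtain ⟨Q, h1, h2, h3⟩ := BSul.finish n (lam 0) (fun i => lam ((i : ℕ) + 1))
    (BSul.good_all n (lam 0) (fun i => lam ((i : ℕ) + 1))
      (fun i => hneg _ (by omega) (by omega)) (by linarith))
  refine ⟨Q, h1, h2, ?_⟩
  convert h3 using 1
  funext i
  refine Fin.cases ?_ (fun k => ?_) i <;> simp
end

section
/- Let Q1 be an (m+1)×(m+1) nonnegative bisymmetric real matrix with eigenvalues (with multiplicity) α0 ≥ α1 ≥ ... ≥ αm, and let Q2 be an (n+1)×(n+1) nonnegative bisymmetric real matrix with eigenvalues (with multiplicity) β0 ≥ β1 ≥ ... ≥ βn. If α0 ≥ β0 and at least one of m, n is odd, then for every ε ≥ 0 there exists an (m+n+2)×(m+n+2) nonnegative bisymmetric real matrix whose eigenvalues (with multiplicity) are α0 + ε, β0 − ε, α1, ..., αm, β1, ..., βn. -/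
open Matrix Polynomial BigOperators

lemma revId_conj {n : ℕ} (Q : Matrix (Fin n) (Fin n) ℝ) (i j : Fin n) :
    (revId n * Q * revId n) i j = Q i.rev j.rev := by
  have h1 : ∀ a b : Fin n, ((a : ℕ) + (b : ℕ) + 1 = n) ↔ b = a.rev := by
    intro a b
    rw [Fin.ext_iff, Fin.val_rev]
    omega
  have h2 : ∀ a b : Fin n, ((a : ℕ) + (b : ℕ) + 1 = n) ↔ a = b.rev := by
    intro a b
    rw [Fin.ext_iff, Fin.val_rev]
    omega
  rw [Matrix.mul_apply]
  have : ∀ k, (revId n * Q) i k = Q i.rev k := by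
    intro k
    rw [Matrix.mul_apply]
    simp only [revId, Matrix.of_apply, h1, ite_mul, one_mul, zero_mul]
    simp
  simp only [this]
  simp only [revId, Matrix.of_apply, h2, mul_ite, mul_one, mul_zero]
  simp

lemma isBisymm_iff {n : ℕ} (Q : Matrix (Fin n) (Fin n) ℝ) :
    IsBisymm Q ↔ (∀ i j, Q j i = Q i j) ∧ ∀ i j, Q i.rev j.rev = Q i j := by
  unfold IsBisymm
  constructor
  · rintro ⟨h, h'⟩
    refine ⟨fun i j => congrFun (congrFun h i) j, fun i j => ?_⟩
    rw [← revId_conj Q, h']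
  · rintro ⟨h, h'⟩
    refine ⟨by ext i j; exact h i j, ?_⟩
    ext i j
    rw [revId_conj, h']

lemma perron_vec (m : ℕ) (Q : Matrix (Fin (m + 1)) (Fin (m + 1)) ℝ) (α : ℕ → ℝ)
    (hα : ∀ i j, i ≤ j → j ≤ m → α j ≤ α i)
    (hnn : MatNonneg Q) (hbs : IsBisymm Q) (heig : HasEigs Q fun i => α (i : ℕ)) :
    ∃ u : Fin (m + 1) → ℝ, (∀ i, 0 ≤ u i) ∧ (∀ i, u i.rev = u i) ∧ 0 < u ⬝ᵥ u ∧
      Q *ᵥ u = α 0 • u := by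
  obtain ⟨hs, hr⟩ := (isBisymm_iff Q).1 hbs
  have hH : Q.IsHermitian := by
    ext i j; simpa using hs i j
  have hroot : ∀ t, Q.charpoly.IsRoot t → ∃ i : Fin (m+1), t = α i := by
    intro t ht
    rw [heig, Polynomial.IsRoot, Polynomial.eval_prod, Finset.prod_eq_zero_iff] at ht
    obtain ⟨i, -, hi⟩ := ht
    exact ⟨i, by simpa [sub_eq_zero] using hi⟩
  set P : Matrix (Fin (m+1)) (Fin (m+1)) ℝ := α 0 • 1 - Q with hP
  have hPH : P.IsHermitian := by
    ext i j
    simp [hP, Matrix.one_apply, hs i j, eq_comm]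
  have hpsd : P.PosSemidef := by
    rw [hPH.posSemidef_iff_eigenvalues_nonneg]
    intro i
    have hv := hPH.mulVec_eigenvectorBasis i
    set μ := hPH.eigenvalues i
    set w : Fin (m+1) → ℝ := ⇑(hPH.eigenvectorBasis i) with hw
    have hw0 : w ≠ 0 := by
      intro h
      have := hPH.eigenvectorBasis.orthonormal.ne_zero i
      apply this
      ext k
      exact congrFun h k
    have hroot' : Q.charpoly.IsRoot (α 0 - μ) := by
      rw [Polynomial.IsRoot, Matrix.eval_charpoly]
      apply Matrix.exists_mulVec_eq_zero_iff.1
      refine ⟨w, hw0, ?_⟩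
      rw [hP, Matrix.sub_mulVec, Matrix.smul_mulVec, Matrix.one_mulVec] at hv
      rw [Matrix.sub_mulVec]
      have : (Matrix.scalar (Fin (m+1))) (α 0 - μ) *ᵥ w = (α 0 - μ) • w := by
        ext k; simp [Matrix.scalar_apply, Matrix.mulVec_diagonal]
      rw [this, sub_smul, ← hv]
      abel
    obtain ⟨k, hk⟩ := hroot _ hroot'
    have := hα 0 k (Nat.zero_le _) (by omega)
    show 0 ≤ μ
    linarith
  have hdet : (Matrix.scalar (Fin (m+1)) (α 0) - Q).det = 0 := by
    rw [← Matrix.eval_charpoly, heig, Polynomial.eval_prod]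
    exact Finset.prod_eq_zero (Finset.mem_univ 0) (by simp)
  obtain ⟨x, hx0, hx⟩ := Matrix.exists_mulVec_eq_zero_iff.2 hdet
  have hPs : P = Matrix.scalar (Fin (m+1)) (α 0) - Q := by
    ext i j; simp [hP, Matrix.scalar_apply, Matrix.diagonal_apply, Matrix.one_apply]
  rw [← hPs] at hx
  set y : Fin (m+1) → ℝ := fun i => |x i| with hy
  have hPy : P *ᵥ y = 0 := by
    have hle : y ⬝ᵥ (P *ᵥ y) ≤ x ⬝ᵥ (P *ᵥ x) := by
      simp only [hP, Matrix.sub_mulVec, Matrix.smul_mulVec, Matrix.one_mulVec, dotProduct_sub,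
        dotProduct_smul]
      have e1 : y ⬝ᵥ y = x ⬝ᵥ x := by
        simp [dotProduct, hy]
      have e2 : x ⬝ᵥ (Q *ᵥ x) ≤ y ⬝ᵥ (Q *ᵥ y) := by
        simp only [dotProduct, Matrix.mulVec, Finset.mul_sum]
        refine Finset.sum_le_sum fun i _ => Finset.sum_le_sum fun j _ => ?_
        have : x i * x j ≤ |x i| * |x j| := by
          rw [← abs_mul]; exact le_abs_self _
        have := mul_le_mul_of_nonneg_left this (hnn i j)
        simp only [hy]
        nlinarith
      rw [e1]
      linarith
    rw [hx, dotProduct_zero] at hle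
    have h0 := hpsd.dotProduct_mulVec_nonneg y
    rw [star_trivial] at h0
    have := (hpsd.dotProduct_mulVec_zero_iff y).1 (by rw [star_trivial]; linarith)
    exact this
  have hQy : Q *ᵥ y = α 0 • y := by
    rw [hP, Matrix.sub_mulVec, Matrix.smul_mulVec, Matrix.one_mulVec, sub_eq_zero] at hPy
    exact hPy.symm
  refine ⟨fun i => y i + y i.rev, ?_, ?_, ?_, ?_⟩
  · intro i; simp only [hy]; positivity
  · intro i; simp [add_comm]
  · obtain ⟨k, hk⟩ := Function.ne_iff.1 hx0
    have hk' : 0 < |x k| := abs_pos.2 hk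
    unfold dotProduct
    refine Finset.sum_pos' (fun i _ => mul_self_nonneg _) ⟨k, Finset.mem_univ _, ?_⟩
    have : 0 < y k + y k.rev := by simp only [hy]; positivity
    positivity
  · ext i
    have a1 := congrFun hQy i
    have a2 := congrFun hQy i.rev
    simp only [Matrix.mulVec, dotProduct, Pi.smul_apply, smul_eq_mul] at a1 a2 ⊢
    rw [mul_add, ← a1, ← a2]
    simp only [mul_add, Finset.sum_add_distrib]
    congr 1
    rw [← Equiv.sum_comp Fin.revPerm]
    refine Finset.sum_congr rfl fun j _ => ?_
    simp only [Fin.revPerm_apply, Fin.rev_rev]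
    rw [← hr i j.rev, Fin.rev_rev]

lemma exists_equiv_rev (a b N : ℕ) (hN : a + b = N) (ha : Even a) :
    ∃ e : Fin a ⊕ Fin b ≃ Fin N, (∀ i, e (Sum.inl i.rev) = (e (Sum.inl i)).rev) ∧
      (∀ i, e (Sum.inr i.rev) = (e (Sum.inr i)).rev) := by
  obtain ⟨p, hp⟩ := ha
  let f : Fin a ⊕ Fin b → Fin N := Sum.elim
    (fun i => if h : (i : ℕ) < p then ⟨i, by omega⟩ else ⟨i + b, by omega⟩)
    (fun j => ⟨j + p, by omega⟩)
  have hl : ∀ i : Fin a, (f (Sum.inl i) : ℕ) = if (i : ℕ) < p then (i : ℕ) else i + b := by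
    intro i; simp only [f, Sum.elim_inl]; split_ifs <;> rfl
  have hr : ∀ i : Fin b, (f (Sum.inr i) : ℕ) = i + p := by
    intro i; rfl
  have hinj : Function.Injective f := by
    rintro (i | i) (j | j) h <;> rw [Fin.ext_iff] at h <;> simp only [hl, hr] at h
    · congr 1; ext; split_ifs at h <;> omega
    · exfalso; split_ifs at h <;> omega
    · exfalso; split_ifs at h <;> omega
    · congr 1; ext; omega
  have hbij : Function.Bijective f :=
    (Fintype.bijective_iff_injective_and_card f).2 ⟨hinj, by simp [hN]⟩
  refine ⟨Equiv.ofBijective f hbij, ?_, ?_⟩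
  · intro i
    simp only [Equiv.ofBijective_apply]
    ext
    rw [Fin.val_rev, hl, hl, Fin.val_rev]
    split_ifs <;> omega
  · intro i
    simp only [Equiv.ofBijective_apply]
    ext
    rw [Fin.val_rev, hr, hr, Fin.val_rev]
    omega

lemma det_block {ι κ : Type*} [Fintype ι] [DecidableEq ι] [Fintype κ] [DecidableEq κ]
    (A : Matrix ι ι ℝ) (B : Matrix κ κ ℝ) (u : ι → ℝ) (v : κ → ℝ) (a b c : ℝ)
    (hA : A.det ≠ 0) (hB : B.det ≠ 0) (ha : a ≠ 0) (hb : b ≠ 0)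
    (hAu : A *ᵥ u = a • u) (hBv : B *ᵥ v = b • v) :
    (Matrix.fromBlocks A (-c • vecMulVec u v) (-c • vecMulVec v u) B).det * (a * b) =
      A.det * B.det * (a * b - c ^ 2 * (u ⬝ᵥ u) * (v ⬝ᵥ v)) := by
  have iA : IsUnit A.det := isUnit_iff_ne_zero.2 hA
  have iB : IsUnit B.det := isUnit_iff_ne_zero.2 hB
  let _ : Invertible A := A.invertibleOfIsUnitDet iA
  have hAi : A⁻¹ *ᵥ u = a⁻¹ • u := by
    have : u = a⁻¹ • (A *ᵥ u) := by rw [hAu, smul_smul, inv_mul_cancel₀ ha, one_smul]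
    nth_rewrite 1 [this]
    rw [Matrix.mulVec_smul, Matrix.mulVec_mulVec, Matrix.nonsing_inv_mul _ iA, Matrix.one_mulVec]
  have hBi : B⁻¹ *ᵥ v = b⁻¹ • v := by
    have : v = b⁻¹ • (B *ᵥ v) := by rw [hBv, smul_smul, inv_mul_cancel₀ hb, one_smul]
    nth_rewrite 1 [this]
    rw [Matrix.mulVec_smul, Matrix.mulVec_mulVec, Matrix.nonsing_inv_mul _ iB, Matrix.one_mulVec]
  rw [Matrix.det_fromBlocks₁₁, Matrix.invOf_eq_nonsing_inv]
  have h1 : (-c • vecMulVec v u) * A⁻¹ * (-c • vecMulVec u v)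
      = (c ^ 2 * a⁻¹ * (u ⬝ᵥ u)) • vecMulVec v v := by
    rw [Matrix.mul_assoc, Matrix.mul_smul, Matrix.mul_vecMulVec, hAi, Matrix.smul_mul,
      Matrix.mul_smul, Matrix.vecMulVec_mul_vecMulVec]
    ext i j
    simp [vecMulVec_apply]
    ring
  have h2 : B - (c ^ 2 * a⁻¹ * (u ⬝ᵥ u)) • vecMulVec v v =
      B * (1 + vecMulVec (-(c ^ 2 * a⁻¹ * (u ⬝ᵥ u) * b⁻¹) • v) v) := by
    rw [Matrix.mul_add, Matrix.mul_one, Matrix.mul_vecMulVec, Matrix.mulVec_smul, hBv]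
    ext i j
    simp [vecMulVec_apply]
    field_simp
    ring
  rw [h1, h2, Matrix.det_mul, Matrix.vecMulVec_eq Unit,
    Matrix.det_one_add_replicateCol_mul_replicateRow]
  simp only [dotProduct_smul, smul_eq_mul]
  field_simp
  ring

lemma charpoly_block_s8 {ι κ : Type*} [Fintype ι] [DecidableEq ι] [Fintype κ] [DecidableEq κ]
    (A : Matrix ι ι ℝ) (B : Matrix κ κ ℝ) (u : ι → ℝ) (v : κ → ℝ) (a b c : ℝ)
    (hAu : A *ᵥ u = a • u) (hBv : B *ᵥ v = b • v) :
    (Matrix.fromBlocks A (c • vecMulVec u v) (c • vecMulVec v u) B).charpoly *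
        ((X - C a) * (X - C b)) =
      A.charpoly * B.charpoly * ((X - C a) * (X - C b) - C (c ^ 2 * (u ⬝ᵥ u) * (v ⬝ᵥ v))) := by
  set p : ℝ[X] := A.charpoly * B.charpoly * ((X - C a) * (X - C b)) with hp
  have hp0 : p ≠ 0 := by
    have := A.charpoly_monic.ne_zero
    have := B.charpoly_monic.ne_zero
    have := X_sub_C_ne_zero a
    have := X_sub_C_ne_zero b
    positivity
  apply Polynomial.eq_of_infinite_eval_eq
  have hfin : {t : ℝ | p.IsRoot t}.Finite := Polynomial.finite_setOfPred_isRoot hp0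
  refine (hfin.infinite_compl).mono ?_
  intro t ht
  have ht' : p.eval t ≠ 0 := ht
  rw [hp] at ht'
  simp only [eval_mul, eval_sub, eval_X, eval_C, mul_ne_zero_iff, Matrix.eval_charpoly] at ht'
  obtain ⟨⟨hA, hB⟩, ha, hb⟩ := ht'
  have key := det_block (Matrix.scalar ι t - A) (Matrix.scalar κ t - B) u v (t - a) (t - b) c
    hA hB ha hb (by
      rw [Matrix.sub_mulVec, hAu, sub_smul]; congr 1
      ext k; simp [Matrix.scalar_apply, Matrix.mulVec_diagonal]) (by
      rw [Matrix.sub_mulVec, hBv, sub_smul]; congr 1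
      ext k; simp [Matrix.scalar_apply, Matrix.mulVec_diagonal])
  show eval t _ = eval t _
  simp only [eval_mul, eval_sub, eval_X, eval_C, Matrix.eval_charpoly]
  rw [← key]
  congr 2
  ext (i | i) (j | j) <;> simp [Matrix.scalar_apply, Matrix.diagonal_apply]

lemma prod_Icc (m : ℕ) (α : ℕ → ℝ) :
    (∏ i : Fin (m + 1), (X - C (α i))) =
      (X - C (α 0)) * (((Finset.Icc 1 m).val.map α).map fun a => X - C a).prod := by
  rw [Fin.prod_univ_succ, Multiset.map_map]
  congr 1
  change _ = ∏ i ∈ Finset.Icc 1 m, (X - C (α i))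
  simp only [Fin.val_succ]
  rw [Fin.prod_univ_eq_prod_range (fun i => X - C (α (i+1))) m]
  rw [Finset.range_eq_Ico, Finset.prod_Ico_add' (fun i => X - C (α i)) 0 m 1]
  rfl

/-- Lemma 3.2: if `Q₁` is nonnegative bisymmetric with eigenvalues `α₀ ≥ … ≥ α_m`,
`Q₂` is nonnegative bisymmetric with eigenvalues `β₀ ≥ … ≥ β_n`, `α₀ ≥ β₀`, and `m` or
`n` is odd, then for every `ε ≥ 0` there is a nonnegative bisymmetric matrix with
eigenvalues `α₀ + ε, β₀ - ε, α₁, …, α_m, β₁, …, β_n`. -/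
theorem bisymm_perturb_pair (m n : ℕ)
    (Q1 : Matrix (Fin (m + 1)) (Fin (m + 1)) ℝ)
    (Q2 : Matrix (Fin (n + 1)) (Fin (n + 1)) ℝ)
    (α β : ℕ → ℝ)
    (hα : ∀ i j, i ≤ j → j ≤ m → α j ≤ α i)
    (hβ : ∀ i j, i ≤ j → j ≤ n → β j ≤ β i)
    (hQ1nn : MatNonneg Q1) (hQ1bs : IsBisymm Q1)
    (hQ1eig : HasEigs Q1 fun i => α (i : ℕ))
    (hQ2nn : MatNonneg Q2) (hQ2bs : IsBisymm Q2)
    (hQ2eig : HasEigs Q2 fun i => β (i : ℕ))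
    (hαβ : β 0 ≤ α 0) (hodd : Odd m ∨ Odd n)
    (ε : ℝ) (hε : 0 ≤ ε) :
    ∃ Q : Matrix (Fin (m + n + 2)) (Fin (m + n + 2)) ℝ,
      MatNonneg Q ∧ IsBisymm Q ∧
        HasEigsM Q ((α 0 + ε) ::ₘ (β 0 - ε) ::ₘ
          (((Finset.Icc 1 m).val.map α) + ((Finset.Icc 1 n).val.map β))) := by
  obtain ⟨u, hu0, hur, huu, hu⟩ := perron_vec m Q1 α hα hQ1nn hQ1bs hQ1eig
  obtain ⟨v, hv0, hvr, hvv, hv⟩ := perron_vec n Q2 β hβ hQ2nn hQ2bs hQ2eig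
  obtain ⟨hs1, hr1⟩ := (isBisymm_iff Q1).1 hQ1bs
  obtain ⟨hs2, hr2⟩ := (isBisymm_iff Q2).1 hQ2bs
  have he : ∃ e : Fin (m + 1) ⊕ Fin (n + 1) ≃ Fin (m + n + 2),
      (∀ i, e (Sum.inl i.rev) = (e (Sum.inl i)).rev) ∧
      (∀ i, e (Sum.inr i.rev) = (e (Sum.inr i)).rev) := by
    rcases hodd with h | h
    · exact exists_equiv_rev _ _ _ (by omega) h.add_one
    · obtain ⟨e, h1, h2⟩ :=
        exists_equiv_rev (n + 1) (m + 1) (m + n + 2) (by omega) h.add_one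
      exact ⟨(Equiv.sumComm _ _).trans e, fun i => by simpa using h2 i,
        fun i => by simpa using h1 i⟩
  obtain ⟨e, he1, he2⟩ := he
  set c : ℝ := Real.sqrt (ε * (α 0 - β 0 + ε) / ((u ⬝ᵥ u) * (v ⬝ᵥ v))) with hc
  have hc0 : 0 ≤ c := Real.sqrt_nonneg _
  have hc2 : c ^ 2 * (u ⬝ᵥ u) * (v ⬝ᵥ v) = ε * (α 0 - β 0 + ε) := by
    have : 0 ≤ α 0 - β 0 + ε := by linarith
    rw [hc, Real.sq_sqrt (by positivity)]
    field_simp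
  set M := Matrix.fromBlocks Q1 (c • vecMulVec u v) (c • vecMulVec v u) Q2 with hM
  have hMnn : ∀ i j, 0 ≤ M i j := by
    rintro (i | i) (j | j)
    · exact hQ1nn i j
    · exact mul_nonneg hc0 (mul_nonneg (hu0 i) (hv0 j))
    · exact mul_nonneg hc0 (mul_nonneg (hv0 i) (hu0 j))
    · exact hQ2nn i j
  have hMs : ∀ i j, M j i = M i j := by
    rintro (i | i) (j | j)
    · exact hs1 i j
    · simp [hM, vecMulVec_apply, mul_comm]
    · simp [hM, vecMulVec_apply, mul_comm]
    · exact hs2 i j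
  set r : Fin (m + 1) ⊕ Fin (n + 1) → Fin (m + 1) ⊕ Fin (n + 1) := Sum.map Fin.rev Fin.rev
  have hMr : ∀ i j, M (r i) (r j) = M i j := by
    rintro (i | i) (j | j)
    · exact hr1 i j
    · simp [hM, r, vecMulVec_apply, hur, hvr]
    · simp [hM, r, vecMulVec_apply, hur, hvr]
    · exact hr2 i j
  have her : ∀ k, (e k).rev = e (r k) := by
    rintro (i | i)
    · exact (he1 i).symm
    · exact (he2 i).symm
  have hes : ∀ i, e.symm i.rev = r (e.symm i) := by
    intro i
    rw [Equiv.symm_apply_eq, ← her, Equiv.apply_symm_apply]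
  refine ⟨Matrix.reindex e e M, ?_, ?_, ?_⟩
  · intro i j
    exact hMnn _ _
  · rw [isBisymm_iff]
    refine ⟨fun i j => hMs _ _, fun i j => ?_⟩
    simp only [Matrix.reindex_apply, Matrix.submatrix_apply, hes, hMr]
  · unfold HasEigsM
    rw [Matrix.charpoly_reindex]
    have key := charpoly_block_s8 Q1 Q2 u v (α 0) (β 0) c hu hv
    rw [hQ1eig, hQ2eig, prod_Icc, prod_Icc, hc2] at key
    have hne : ((X - C (α 0)) * (X - C (β 0)) : ℝ[X]) ≠ 0 :=
      mul_ne_zero (X_sub_C_ne_zero _) (X_sub_C_ne_zero _)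
    apply mul_right_cancel₀ hne
    rw [key]
    simp only [Multiset.map_cons, Multiset.prod_cons, Multiset.map_add, Multiset.prod_add,
      C_add, C_sub, C_mul]
    ring
end

section
/- Let λ0 ≥ λ1 ≥ ... ≥ λM ≥ 0 > λ_{M+1} ≥ ... ≥ λn be real numbers. Suppose there exists a partition Λ1 ∪ Λ2 ∪ ... ∪ ΛS of the multiset {λ_{M+1}, λ_{M+2}, ..., λn} with M ≤ S, such that |Λj| is odd for each j = 1, 2, ..., M, and, setting Tk = Σ_{λ ∈ Λk} λ, one has T_S ≥ T_{S−1} ≥ ... ≥ T_1 and, with K = { i ∈ {1,2,...,M} : λi + Ti < 0 }: (1) λ0 + Σ_{i ∈ K, i < k} (λi + Ti) + Tk ≥ 0 for all k ∈ K, and (2) λ0 + Σ_{i ∈ K} (λi + Ti) + Σ_{j=M+1}^{S} Tj ≥ 0. Then there exists an (n+1)×(n+1) nonnegative bisymmetric real matrix whose eigenvalues (with multiplicity) are λ0, λ1, ..., λn. -/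
open Matrix Polynomial BigOperators

/-- Realizability of `μ ::ₘ L` by a nonnegative symmetric matrix invariant under an involution
with at most one fixed point (none if `f`), with a nonnegative invariant unit eigenvector. -/
def Rz (f : Prop) (μ : ℝ) (L : Multiset ℝ) : Prop :=
  ∃ (ι : Type) (_ : Fintype ι) (_ : DecidableEq ι) (σ : ι → ι) (Q : Matrix ι ι ℝ) (v : ι → ℝ),
    (∀ i, σ (σ i) = i) ∧ (∀ i j, σ i = i → σ j = j → i = j) ∧ (f → ∀ i, σ i ≠ i) ∧
    (∀ i j, Q j i = Q i j) ∧ (∀ i j, Q (σ i) (σ j) = Q i j) ∧ (∀ i j, 0 ≤ Q i j) ∧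
    (Q *ᵥ v = μ • v) ∧ (∀ i, 0 ≤ v i) ∧ (∀ i, v (σ i) = v i) ∧ v ⬝ᵥ v = 1 ∧
    Q.charpoly = ((μ ::ₘ L).map fun a => X - Polynomial.C a).prod

lemma rz_resolvent {ι : Type} [Fintype ι] [DecidableEq ι] (A : Matrix ι ι ℝ) (u : ι → ℝ) (α x : ℝ)
    (hu : A *ᵥ u = α • u) (hx : x ≠ α) (hd : IsUnit (scalar ι x - A).det) :
    (scalar ι x - A)⁻¹ *ᵥ u = (x - α)⁻¹ • u := by
  have h1 : (scalar ι x - A) *ᵥ u = (x - α) • u := by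
    rw [Matrix.sub_mulVec, hu, sub_smul]
    congr 1
    ext i
    simp [Matrix.scalar_apply, Matrix.mulVec_diagonal]
  have h2 : u = (x - α) • ((scalar ι x - A)⁻¹ *ᵥ u) := by
    rw [← Matrix.mulVec_smul, ← h1, Matrix.mulVec_mulVec, Matrix.nonsing_inv_mul _ hd,
      Matrix.one_mulVec]
  have : x - α ≠ 0 := sub_ne_zero.2 hx
  conv_rhs => rw [h2]
  rw [smul_smul, inv_mul_cancel₀ this, one_smul]

lemma rz_det {ι κ : Type} [Fintype ι] [DecidableEq ι] [Fintype κ] [DecidableEq κ]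
    (A : Matrix ι ι ℝ) (B : Matrix κ κ ℝ) (u : ι → ℝ) (v : κ → ℝ) (α β c x : ℝ)
    (hu : A *ᵥ u = α • u) (hv : B *ᵥ v = β • v) (huu : u ⬝ᵥ u = 1) (hvv : v ⬝ᵥ v = 1)
    (hxa : x ≠ α) (hxb : x ≠ β)
    (hA : (scalar ι x - A).det ≠ 0) (hB : (scalar κ x - B).det ≠ 0) :
    (scalar (ι ⊕ κ) x - fromBlocks A (c • vecMulVec u v) (c • vecMulVec v u) B).det
      = (scalar ι x - A).det * (scalar κ x - B).det * (1 - c ^ 2 / ((x - α) * (x - β))) := by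
  have hA' : IsUnit (scalar ι x - A).det := isUnit_iff_ne_zero.2 hA
  have hB' : IsUnit (scalar κ x - B).det := isUnit_iff_ne_zero.2 hB
  have e : scalar (ι ⊕ κ) x - fromBlocks A (c • vecMulVec u v) (c • vecMulVec v u) B
      = fromBlocks (scalar ι x - A) (-(c • vecMulVec u v)) (-(c • vecMulVec v u))
          (scalar κ x - B) := by
    ext i j
    rcases i with i | i <;> rcases j with j | j <;>
      simp [Matrix.scalar_apply, Matrix.diagonal_apply]
  rw [e]
  haveI := Matrix.invertibleOfIsUnitDet _ hA'
  rw [Matrix.det_fromBlocks₁₁, mul_assoc]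
  congr 1
  have e2 : scalar κ x - B - -(c • vecMulVec v u) * ⅟(scalar ι x - A) * -(c • vecMulVec u v)
     = scalar κ x - B + replicateCol Unit ((-(c ^ 2 / (x - α))) • v) * replicateRow Unit v := by
    rw [Matrix.invOf_eq_nonsing_inv]
    have h3 : vecMulVec v u * (scalar ι x - A)⁻¹ * vecMulVec u v
        = (x - α)⁻¹ • vecMulVec v v := by
      rw [Matrix.mul_assoc, Matrix.mul_vecMulVec, rz_resolvent A u α x hu hxa hA',
        Matrix.vecMulVec_mul_vecMulVec]
      simp [huu, dotProduct_smul]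
    simp only [Matrix.neg_mul, Matrix.mul_neg, neg_neg, Matrix.smul_mul, Matrix.mul_smul, h3]
    ext i j
    simp [vecMulVec_apply, Matrix.mul_apply]
    ring
  rw [e2, Matrix.det_add_replicateCol_mul_replicateRow hB']
  congr 1
  rw [Matrix.det_unique]
  have h4 : (replicateRow Unit v * (scalar κ x - B)⁻¹ * replicateCol Unit ((-(c ^ 2 / (x - α))) • v))
      default default = v ⬝ᵥ ((scalar κ x - B)⁻¹ *ᵥ ((-(c ^ 2 / (x - α))) • v)) := by
    rw [Matrix.mul_assoc]
    rfl
  rw [Matrix.add_apply, h4, Matrix.mulVec_smul, rz_resolvent B v β x hv hxb hB']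
  simp only [dotProduct_smul, hvv, Matrix.one_apply_eq, smul_eq_mul]
  have : x - α ≠ 0 := sub_ne_zero.2 hxa
  have : x - β ≠ 0 := sub_ne_zero.2 hxb
  field_simp
  ring

lemma rz_charpoly {ι κ : Type} [Fintype ι] [DecidableEq ι] [Fintype κ] [DecidableEq κ]
    (A : Matrix ι ι ℝ) (B : Matrix κ κ ℝ) (u : ι → ℝ) (v : κ → ℝ) (α β c ε : ℝ)
    (hu : A *ᵥ u = α • u) (hv : B *ᵥ v = β • v) (huu : u ⬝ᵥ u = 1) (hvv : v ⬝ᵥ v = 1)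
    (p q : ℝ[X]) (hA : A.charpoly = (X - C α) * p) (hB : B.charpoly = (X - C β) * q)
    (hc : c ^ 2 = ε * (α + ε - β)) :
    (fromBlocks A (c • vecMulVec u v) (c • vecMulVec v u) B).charpoly
      = (X - C (α + ε)) * ((X - C (β - ε)) * (p * q)) := by
  apply Polynomial.eq_of_infinite_eval_eq
  have hne : A.charpoly * B.charpoly ≠ 0 :=
    mul_ne_zero (Matrix.charpoly_monic A).ne_zero (Matrix.charpoly_monic B).ne_zero
  refine ((A.charpoly * B.charpoly).roots.toFinset.finite_toSet.infinite_compl).mono ?_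
  intro x hx
  have hx' : (A.charpoly * B.charpoly).eval x ≠ 0 := by
    intro h
    apply hx
    simp only [Finset.mem_coe, Multiset.mem_toFinset]
    exact (Polynomial.mem_roots hne).2 h
  rw [Polynomial.eval_mul] at hx'
  have hxA := left_ne_zero_of_mul hx'
  have hxB := right_ne_zero_of_mul hx'
  have hxa : x ≠ α := by
    rintro rfl
    simp [hA] at hxA
  have hxb : x ≠ β := by
    rintro rfl
    simp [hB] at hxB
  have key := rz_det A B u v α β c x hu hv huu hvv hxa hxb
    (by rwa [← Matrix.eval_charpoly]) (by rwa [← Matrix.eval_charpoly])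
  show eval x _ = eval x _
  rw [Matrix.eval_charpoly, key, ← Matrix.eval_charpoly, ← Matrix.eval_charpoly, hA, hB]
  have h1 : x - α ≠ 0 := sub_ne_zero.2 hxa
  have h2 : x - β ≠ 0 := sub_ne_zero.2 hxb
  simp only [eval_mul, eval_sub, eval_X, eval_C]
  rw [hc]
  field_simp
  ring

lemma rz_coef (α β ε : ℝ) (hε : 0 ≤ ε) (h : 0 ≤ ε * (α + ε - β)) :
    ∃ c x y : ℝ, 0 ≤ c ∧ 0 ≤ x ∧ 0 ≤ y ∧ x * x + y * y = 1 ∧ c ^ 2 = ε * (α + ε - β) ∧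
      α * x + c * y = (α + ε) * x ∧ c * x + β * y = (α + ε) * y := by
  rcases hε.eq_or_lt with rfl | hε
  · exact ⟨0, 1, 0, by simp⟩
  · set c := √(ε * (α + ε - β)) with hcd
    have hc0 : 0 ≤ c := Real.sqrt_nonneg _
    have hc : c ^ 2 = ε * (α + ε - β) := Real.sq_sqrt h
    have hpos : 0 < c ^ 2 + ε ^ 2 := by positivity
    set r := √(c ^ 2 + ε ^ 2)
    have hr : r ^ 2 = c ^ 2 + ε ^ 2 := Real.sq_sqrt hpos.le
    have hr0 : 0 < r := Real.sqrt_pos.2 hpos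
    refine ⟨c, c / r, ε / r, hc0, by positivity, by positivity, ?_, hc, ?_, ?_⟩
    · field_simp
      linarith
    · field_simp
    · field_simp
      linarith

lemma rz_merge {f : Prop} {α β ε : ℝ} {L L' : Multiset ℝ} (h : Rz f α L) (h' : Rz True β L')
    (hε : 0 ≤ ε) (hc : 0 ≤ ε * (α + ε - β)) :
    Rz f (α + ε) ((β - ε) ::ₘ (L + L')) := by
  obtain ⟨ι, _, _, σ, A, u, hσ, hσ1, hσf, hAs, hAσ, hA0, hu, hu0, huσ, huu, hA⟩ := h
  obtain ⟨κ, _, _, τ, B, v, hτ, hτ1, hτf, hBs, hBσ, hB0, hv, hv0, hvσ, hvv, hB⟩ := h'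
  obtain ⟨c, x, y, hc0, hx0, hy0, hxy, hc2, e1, e2⟩ := rz_coef α β ε hε hc
  have hτf := hτf trivial
  refine ⟨ι ⊕ κ, inferInstance, inferInstance, Sum.map σ τ,
    fromBlocks A (c • vecMulVec u v) (c • vecMulVec v u) B, Sum.elim (x • u) (y • v),
    ?_, ?_, ?_, ?_, ?_, ?_, ?_, ?_, ?_, ?_, ?_⟩
  · rintro (i | i) <;> simp [hσ, hτ]
  · rintro (i | i) (j | j) <;> simp [hτf]
    exact hσ1 i j
  · rintro hf (i | i) <;> simp [hσf, hτf, hf]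
  · rintro (i | i) (j | j)
    · simpa using hAs i j
    · simp [vecMulVec_apply, mul_comm]
    · simp [vecMulVec_apply, mul_comm]
    · simpa using hBs i j
  · rintro (i | i) (j | j) <;> simp [hAσ, hBσ, vecMulVec_apply, huσ, hvσ]
  · rintro (i | i) (j | j) <;> simp [hA0, hB0, vecMulVec_apply]
    · have := hu0 i; have := hv0 j; positivity
    · have := hv0 i; have := hu0 j; positivity
  · rw [Matrix.fromBlocks_mulVec]
    have k1 : vecMulVec u v *ᵥ v = u := by
      ext i; simp [Matrix.vecMulVec_mulVec, hvv]
    have k2 : vecMulVec v u *ᵥ u = v := by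
      ext i; simp [Matrix.vecMulVec_mulVec, huu]
    ext i
    rcases i with i | i
    · simp [Matrix.mulVec_smul, Matrix.smul_mulVec, hu, k1]
      linear_combination u i * e1
    · simp [Matrix.mulVec_smul, Matrix.smul_mulVec, hv, k2]
      linear_combination v i * e2
  · rintro (i | i)
    · have := hu0 i; simp; positivity
    · have := hv0 i; simp; positivity
  · rintro (i | i) <;> simp [huσ, hvσ]
  · have e3 : Sum.elim (x • u) (y • v) ⬝ᵥ Sum.elim (x • u) (y • v)
        = (x • u) ⬝ᵥ (x • u) + (y • v) ⬝ᵥ (y • v) := by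
      simp [dotProduct, Fintype.sum_sum_type]
    rw [e3]
    simp [huu, hvv, hxy]
  · rw [rz_charpoly A B u v α β c ε hu hv huu hvv _ _
      (by rw [hA, Multiset.map_cons, Multiset.prod_cons])
      (by rw [hB, Multiset.map_cons, Multiset.prod_cons]) hc2]
    simp

lemma rz_two (μ a : ℝ) (h : 0 ≤ μ + a) (ha : a ≤ 0) : Rz True μ {a} := by
  have hs : √2 * √2 = (2:ℝ) := Real.mul_self_sqrt (by norm_num)
  refine ⟨Fin 2, inferInstance, inferInstance, Fin.rev, !![(μ + a) / 2, (μ - a) / 2;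
    (μ - a) / 2, (μ + a) / 2], fun _ => 1 / √2, ?_, ?_, ?_, ?_, ?_, ?_, ?_, ?_, ?_, ?_, ?_⟩
  · simp
  · decide
  · decide
  · intro i j; fin_cases i <;> fin_cases j <;> simp
  · intro i j; fin_cases i <;> fin_cases j <;> simp
  · intro i j; fin_cases i <;> fin_cases j <;> simp <;> linarith
  · ext i; fin_cases i <;> simp [Matrix.mulVec, dotProduct, Fin.sum_univ_two] <;> ring
  · intro i; positivity
  · simp
  · simp [dotProduct, Fin.sum_univ_two, ← mul_inv, hs]
  · rw [Matrix.charpoly_fin_two]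
    simp [Matrix.trace_fin_two, Matrix.det_fin_two]
    apply Polynomial.funext
    intro x
    simp
    ring

lemma rz_one (μ : ℝ) (h : 0 ≤ μ) : Rz False μ 0 := by
  refine ⟨Unit, inferInstance, inferInstance, id, fun _ _ => μ, fun _ => 1,
    ?_, ?_, ?_, ?_, ?_, ?_, ?_, ?_, ?_, ?_, ?_⟩
  · simp
  · simp
  · simp
  · simp
  · simp
  · simp [h]
  · ext i; simp [Matrix.mulVec, dotProduct]
  · simp
  · simp
  · simp [dotProduct]
  · simp [Matrix.charpoly, Matrix.charmatrix]
    rfl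

lemma rz_sul (k : ℕ) : ∀ (L : Multiset ℝ) (μ : ℝ), Multiset.card L ≤ k → (∀ a ∈ L, a ≤ 0) →
    0 ≤ μ + L.sum → Rz (Odd (Multiset.card L)) μ L := by
  induction k with
  | zero =>
    intro L μ hk hL hs
    have : L = 0 := by simpa using hk
    subst this
    simpa using rz_one μ (by simpa using hs)
  | succ k ih =>
    intro L μ hk hL hs
    induction L using Multiset.induction_on with
    | empty => simpa using rz_one μ (by simpa using hs)
    | cons a L _ =>
      induction L using Multiset.induction_on with
      | empty =>
        simpa using rz_two μ a (by simpa using hs) (hL a (by simp))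
      | cons b L _ =>
        have ha := hL a (by simp)
        have hb := hL b (by simp)
        have hL' : ∀ x ∈ L, x ≤ 0 := fun x hx => hL x (by simp [hx])
        have hsum : L.sum ≤ 0 := by
          have := Multiset.sum_le_card_nsmul L 0 hL'
          simpa using this
        simp only [Multiset.sum_cons] at hs
        simp only [Multiset.card_cons] at hk
        have r1 := ih L (μ + a + b) (by omega) hL' (by linarith)
        have r2 := rz_merge (ε := -a - b) r1 (rz_two (-a) a (by simp) ha) (by linarith)
          (mul_nonneg (by linarith) (by linarith))
        have e : (Odd (Multiset.card (a ::ₘ b ::ₘ L))) = Odd (Multiset.card L) := by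
          simp only [Multiset.card_cons, add_assoc]
          apply propext
          rw [Nat.odd_add]
          simp
        rw [e]
        convert r2 using 1
        · ring
        · rw [show -a - (-a - b) = b by ring, Multiset.cons_swap, add_comm L {a},
            Multiset.singleton_add]

lemma rz_core (lam : ℕ → ℝ) (Λ : ℕ → Multiset ℝ) (δ : ℕ → ℝ)
    (m : ℕ) (hΛ : ∀ i < m, ∀ a ∈ Λ i, a ≤ 0) (hodd : ∀ i < m, Odd (Multiset.card (Λ i)))
    (hδ : ∀ i < m, δ i = min (lam (i + 1) + (Λ i).sum) 0)
    (h1 : ∀ k < m, lam (k + 1) + (Λ k).sum < 0 →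
      0 ≤ lam 0 + ∑ i ∈ Finset.range k, δ i + (Λ k).sum) :
    ∀ (L : Multiset ℝ), Rz False (lam 0 + ∑ i ∈ Finset.range m, δ i) L →
      Rz False (lam 0) (∑ i ∈ Finset.range m, (lam (i + 1) ::ₘ Λ i) + L) := by
  induction m with
  | zero => intro L h; simpa using h
  | succ m ih =>
    intro L h
    have ih := ih (fun i hi => hΛ i (by omega)) (fun i hi => hodd i (by omega))
      (fun i hi => hδ i (by omega)) (fun k hk => h1 k (by omega))
    have ho := hodd m (by omega)
    have hd := hδ m (by omega)
    have hn := hΛ m (by omega)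
    rw [Finset.sum_range_succ] at h
    have key : Rz False (lam 0 + ∑ i ∈ Finset.range m, δ i) (lam (m + 1) ::ₘ (L + Λ m)) := by
      by_cases hm : lam (m + 1) + (Λ m).sum < 0
      · rw [min_eq_left hm.le] at hd
        have r := rz_sul _ (Λ m) (-(Λ m).sum) le_rfl hn (by simp)
        rw [eq_true ho] at r
        have := h1 m (by omega) hm
        have r2 := rz_merge (ε := -(lam (m + 1) + (Λ m).sum)) h r (by linarith)
          (mul_nonneg (by linarith) (by linarith))
        convert r2 using 1
        · rw [hd]; ring
        · congr 1; ring
      · rw [min_eq_right (not_lt.1 hm)] at hd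
        have r := rz_sul _ (Λ m) (lam (m + 1)) le_rfl hn (not_lt.1 hm)
        rw [eq_true ho] at r
        have r2 := rz_merge (ε := 0) h r le_rfl (by simp)
        convert r2 using 1
        · rw [hd]; ring
        · congr 1; ring
    have := ih _ key
    convert this using 1
    rw [Finset.sum_range_succ, add_assoc, Multiset.cons_add, add_comm L]

lemma rz_cycleType {ι : Type} [Fintype ι] [DecidableEq ι] (σ : Equiv.Perm ι)
    (h2 : ∀ i, σ (σ i) = i) (h1 : ∀ i j, σ i = i → σ j = j → i = j) :
    σ.cycleType = Multiset.replicate (Fintype.card ι / 2) 2 := by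
  have hall : ∀ n ∈ σ.cycleType, n = 2 := by
    intro n hn
    have ha := Equiv.Perm.two_le_of_mem_cycleType hn
    have hb : n ∣ 2 := (Equiv.Perm.dvd_of_mem_cycleType hn).trans
      (orderOf_dvd_of_pow_eq_one (by ext i; simp [sq, h2]))
    exact le_antisymm (Nat.le_of_dvd (by norm_num) hb) ha
  have hr := Multiset.eq_replicate_card.2 hall
  have hs := Equiv.Perm.sum_cycleType σ
  have hle : (σ.supportᶜ).card ≤ 1 := by
    rw [Finset.card_le_one]
    intro a ha b hb
    exact h1 a b (by simpa using ha) (by simpa using hb)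
  rw [Finset.card_compl] at hle
  have hc := Finset.card_le_univ σ.support
  rw [hr]
  rw [hr] at hs
  simp at hs
  congr 1
  omega

lemma rz_final {μ : ℝ} {L : Multiset ℝ} (h : Rz False μ L) (N : ℕ) (l : Fin N → ℝ)
    (hl : Finset.univ.val.map l = μ ::ₘ L) :
    ∃ Q : Matrix (Fin N) (Fin N) ℝ, MatNonneg Q ∧ IsBisymm Q ∧ HasEigs Q l := by
  obtain ⟨ι, _, _, σ, A, u, hσ, hσ1, -, hAs, hAσ, hA0, -, -, -, -, hA⟩ := h
  have hA' : A.charpoly = ∏ i, (X - C (l i)) := by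
    rw [hA, ← hl, Multiset.map_map]
    rfl
  have hcard : Fintype.card ι = N := by
    have := congrArg Polynomial.natDegree hA'
    rw [Matrix.charpoly_natDegree_eq_dim, Polynomial.natDegree_finsetProd_X_sub_C_eq_card] at this
    simpa using this
  obtain ⟨e0⟩ : Nonempty (ι ≃ Fin N) := ⟨Fintype.equivFinOfCardEq hcard⟩
  let s : Equiv.Perm ι := ⟨σ, σ, hσ, hσ⟩
  let s' : Equiv.Perm (Fin N) := (e0.symm.trans s).trans e0
  have hs' : ∀ i, s' i = e0 (σ (e0.symm i)) := fun i => rfl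
  have hcy : s'.cycleType = (Fin.revPerm : Equiv.Perm (Fin N)).cycleType := by
    rw [rz_cycleType s', rz_cycleType Fin.revPerm]
    · simp
    · intro i j hi hj
      simp only [Fin.revPerm_apply, Fin.ext_iff, Fin.val_rev] at hi hj ⊢
      omega
    · intro i; simp [hs', hσ]
    · intro i j hi hj
      rw [hs', ← Equiv.eq_symm_apply] at hi hj
      exact e0.symm.injective (hσ1 _ _ hi hj)
  obtain ⟨g, hg⟩ := isConj_iff.1 (Equiv.Perm.isConj_iff_cycleType_eq.2 hcy)
  let e : ι ≃ Fin N := e0.trans g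
  have he : ∀ i, e.symm (Fin.rev i) = σ (e.symm i) := by
    intro i
    rw [Equiv.symm_apply_eq]
    have := congrArg (fun p : Equiv.Perm (Fin N) => p i) hg
    simp only [Fin.revPerm_apply, Equiv.Perm.mul_apply, hs'] at this
    rw [← this]
    rfl
  refine ⟨Matrix.reindex e e A, ?_, ⟨?_, ?_⟩, ?_⟩
  · intro i j; exact hA0 _ _
  · ext i j; exact hAs _ _
  · have hJ : ∀ i j : Fin N, revId N i j = if j = Fin.rev i then 1 else 0 := by
      intro i j
      simp only [revId, Matrix.of_apply, Fin.ext_iff, Fin.val_rev]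
      congr 1
      apply propext
      omega
    have hJ' : ∀ i j : Fin N, revId N i j = if i = Fin.rev j then 1 else 0 := by
      intro i j
      rw [hJ]
      congr 1
      apply propext
      rw [← Fin.rev_eq_iff, eq_comm]
    ext i j
    rw [Matrix.mul_apply]
    simp_rw [Matrix.mul_apply]
    simp_rw [hJ' _ j, hJ i]
    simp [he, hAσ]
  · rw [HasEigs, Matrix.charpoly_reindex, hA']


/-- Borobia-type condition for the BNIEP, case `M ≤ S` (Theorem 3.3): with a partition
`Λ₁ ∪ … ∪ Λ_S` of the negative part into parts of odd size for `j = 1, …, M`, part sums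
`T_S ≥ … ≥ T₁`, and Kellogg-type inequalities, the list `λ₀, …, λₙ` is realizable by a
nonnegative bisymmetric matrix. (Here `Λ j`, `T j`, `j : Fin S`, represent `Λ_{j+1}`,
`T_{j+1}`.) -/
theorem bniep_borobia_M_le_S (n M S : ℕ) (hMn : M ≤ n) (hMS : M ≤ S)
    (lam : ℕ → ℝ)
    (hanti : ∀ i j, i ≤ j → j ≤ n → lam j ≤ lam i)
    (hM0 : 0 ≤ lam M)
    (hneg : ∀ i, M < i → i ≤ n → lam i < 0)
    (Λ : Fin S → Multiset ℝ)
    (hpart : (∑ j, Λ j) = (Finset.Icc (M + 1) n).val.map lam)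
    (hodd : ∀ j : Fin S, (j : ℕ) < M → Odd (Multiset.card (Λ j)))
    (T : Fin S → ℝ) (hT : ∀ j, T j = (Λ j).sum)
    (hTmono : Monotone T)
    (K : Finset (Fin S))
    (hK : K = Finset.univ.filter fun i : Fin S =>
      (i : ℕ) < M ∧ lam ((i : ℕ) + 1) + T i < 0)
    (h1 : ∀ k ∈ K,
      0 ≤ lam 0 + (∑ i ∈ K.filter fun i => i < k, (lam ((i : ℕ) + 1) + T i)) + T k)
    (h2 : 0 ≤ lam 0 + (∑ i ∈ K, (lam ((i : ℕ) + 1) + T i))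
        + ∑ j ∈ Finset.univ.filter fun j : Fin S => M ≤ (j : ℕ), T j) :
    ∃ Q : Matrix (Fin (n + 1)) (Fin (n + 1)) ℝ,
      MatNonneg Q ∧ IsBisymm Q ∧ HasEigs Q fun i => lam (i : ℕ) := by
  classical
  have hnp : ∀ j, ∀ a ∈ Λ j, a ≤ 0 := by
    intro j a ha
    have h : a ∈ ∑ j, Λ j := by
      rw [Multiset.mem_sum]
      exact ⟨j, Finset.mem_univ _, ha⟩
    rw [hpart, Multiset.mem_map] at h
    obtain ⟨i, hi, rfl⟩ := h
    rw [Finset.mem_val, Finset.mem_Icc] at hi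
    exact (hneg i (by omega) hi.2).le
  set Λ' : ℕ → Multiset ℝ := fun i => if h : i < S then Λ ⟨i, h⟩ else 0 with hΛ'
  have hΛj : ∀ (i : ℕ) (h : i < S), Λ' i = Λ ⟨i, h⟩ := fun i h => by simp [hΛ', h]
  set δ : ℕ → ℝ := fun i => min (lam (i + 1) + (Λ' i).sum) 0 with hδ
  -- sums over `K` as sums over ranges
  have hsum : ∀ k ≤ M, ∑ i ∈ Finset.range k, δ i
      = ∑ i ∈ K.filter (fun i : Fin S => (i : ℕ) < k), (lam ((i : ℕ) + 1) + T i) := by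
    intro k hk
    have e1 : ∑ i ∈ Finset.range k, δ i
        = ∑ i ∈ Finset.univ.filter (fun i : Fin S => (i : ℕ) < k), δ i := by
      symm
      refine Finset.sum_bij (fun i _ => (i : ℕ)) ?_ ?_ ?_ ?_
      · intro i hi; simpa using hi
      · intro i _ j _ h; exact Fin.ext h
      · intro b hb
        have hb := Finset.mem_range.1 hb
        exact ⟨⟨b, by omega⟩, by simpa using hb, rfl⟩
      · intro i _; rfl
    rw [e1, hK, Finset.filter_filter]
    rw [← Finset.sum_filter_add_sum_filter_not _ (fun i : Fin S => lam ((i : ℕ) + 1) + T i < 0),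
      Finset.filter_filter, Finset.filter_filter]
    have z : ∑ i ∈ Finset.univ.filter
        (fun i : Fin S => (i : ℕ) < k ∧ ¬ lam ((i : ℕ) + 1) + T i < 0), δ i = 0 := by
      apply Finset.sum_eq_zero
      intro i hi
      have hi := (Finset.mem_filter.1 hi).2.2
      simp only [hδ, hΛj _ i.2]
      rw [hT] at hi
      exact min_eq_right (not_lt.1 hi)
    rw [z, add_zero]
    apply Finset.sum_congr
    · ext i
      simp only [Finset.mem_filter, Finset.mem_univ, true_and]
      constructor
      · rintro ⟨a, b⟩; exact ⟨⟨by omega, b⟩, a⟩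
      · rintro ⟨⟨a, b⟩, d⟩; exact ⟨d, b⟩
    · intro i hi
      have hi := (Finset.mem_filter.1 hi).2.1.2
      simp only [hδ, hΛj _ i.2]
      rw [hT] at hi ⊢
      exact min_eq_left hi.le
  have hfull : K.filter (fun i : Fin S => (i : ℕ) < M) = K := by
    rw [hK, Finset.filter_filter]
    ext i
    simp only [Finset.mem_filter, Finset.mem_univ, true_and]
    tauto
  set L0 : Multiset ℝ := ∑ j ∈ Finset.univ.filter (fun j : Fin S => M ≤ (j : ℕ)), Λ j with hL0
  have hbase : Rz False (lam 0 + ∑ i ∈ Finset.range M, δ i) L0 := by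
    have r := rz_sul _ L0 (lam 0 + ∑ i ∈ Finset.range M, δ i) le_rfl ?_ ?_
    · obtain ⟨ι, i1, i2, σ, A, u, a1, a2, -, a3⟩ := r
      exact ⟨ι, i1, i2, σ, A, u, a1, a2, False.elim, a3⟩
    · intro a ha
      rw [hL0, Multiset.mem_sum] at ha
      obtain ⟨j, -, hj⟩ := ha
      exact hnp j a hj
    · rw [hsum M le_rfl, hfull, hL0, Multiset.sum_sum]
      simpa only [hT] using h2
  have hfin := rz_core lam Λ' δ M
    (fun i hi a ha => by
      rw [hΛj i (by omega)] at ha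
      exact hnp _ a ha)
    (fun i hi => by rw [hΛj i (by omega)]; exact hodd _ hi)
    (fun i _ => rfl)
    (fun k hk hlt => by
      rw [hΛj k (by omega)] at hlt ⊢
      rw [hsum k hk.le, ← hT]
      rw [← hT] at hlt
      have := h1 ⟨k, by omega⟩ (by rw [hK]; simp [hk, hlt])
      simpa [Fin.lt_def] using this) L0 hbase
  apply rz_final hfin (n + 1)
  -- bookkeeping of the spectrum
  have e2 : ∑ i ∈ Finset.range M, Λ' i + L0 = ∑ j, Λ j := by
    rw [hL0, ← Finset.sum_filter_add_sum_filter_not Finset.univ (fun j : Fin S => (j : ℕ) < M)]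
    congr 1
    · symm
      refine Finset.sum_bij (fun i _ => (i : ℕ)) ?_ ?_ ?_ ?_
      · intro i hi; simpa using hi
      · intro i _ j _ h; exact Fin.ext h
      · intro b hb
        have hb := Finset.mem_range.1 hb
        exact ⟨⟨b, by omega⟩, by simpa using hb, rfl⟩
      · intro i _; exact (hΛj _ i.2).symm
    · simp only [not_lt]
  have e3 : ∑ i ∈ Finset.range M, (lam (i + 1) ::ₘ Λ' i) + L0
      = ∑ i ∈ Finset.range M, {lam (i + 1)} + (Finset.Icc (M + 1) n).val.map lam := by
    rw [← hpart, ← e2, ← add_assoc, ← Finset.sum_add_distrib]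
    simp only [Multiset.singleton_add]
  have e4 : ∀ (s : Finset ℕ) (g : ℕ → ℝ), s.val.map g = ∑ i ∈ s, ({g i} : Multiset ℝ) := by
    intro s g
    rw [Finset.sum, ← Multiset.sum_map_singleton (s.val.map g), Multiset.map_map]
    rfl
  have e5 : (Finset.univ : Finset (Fin (n + 1))).val.map (fun i : Fin (n + 1) => lam (i : ℕ))
      = ∑ i ∈ Finset.range (n + 1), ({lam i} : Multiset ℝ) := by
    rw [← Fin.sum_univ_eq_sum_range (fun i => ({lam i} : Multiset ℝ)), Finset.sum,
      ← Multiset.sum_map_singleton (Multiset.map _ _), Multiset.map_map]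
    rfl
  rw [e3, e5, e4, ← Multiset.singleton_add, Finset.sum_range_succ', add_comm]
  congr 1
  rw [← Finset.sum_range_add_sum_Ico _ hMn]
  congr 1
  rw [Finset.sum_Ico_add' (fun i => ({lam i} : Multiset ℝ)) M n 1]
  rfl
end

section
/- Let λ0 ≥ λ1 ≥ ... ≥ λM ≥ 0 > λ_{M+1} ≥ ... ≥ λn be real numbers with M ≥ 1. Suppose there exists a partition Λ1 ∪ Λ2 ∪ ... ∪ Λ_{M−1} of the multiset {λ_{M+1}, λ_{M+2}, ..., λn} such that |Λj| is odd for each j = 1, 2, ..., M−1, and, setting Tk = Σ_{λ ∈ Λk} λ, one has T_{M−1} ≥ ... ≥ T_1 and, with K = { i ∈ {1,2,...,M−1} : λi + Ti < 0 }: (1) λ0 + Σ_{i ∈ K, i < k} (λi + Ti) + Tk ≥ 0 for all k ∈ K, and (2) λ0 + Σ_{i ∈ K} (λi + Ti) ≥ 0. Then there exists an (n+1)×(n+1) nonnegative bisymmetric real matrix whose eigenvalues (with multiplicity) are λ0, λ1, ..., λn. -/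
open Matrix Polynomial BigOperators

/-- There is a symmetric nonnegative matrix with eigenvalues `E` and diagonal entries `D`. -/
def SymReal (E D : Multiset ℝ) : Prop :=
  ∃ (m : ℕ) (A : Matrix (Fin m) (Fin m) ℝ), Aᵀ = A ∧ (∀ i j, 0 ≤ A i j) ∧
    A.charpoly = (E.map fun a => X - Polynomial.C a).prod ∧
    (Finset.univ : Finset (Fin m)).val.map (fun i => A i i) = D

lemma msum_nonpos (L : Multiset ℝ) : (∀ a ∈ L, a < 0) → L.sum ≤ 0 := by
  induction L using Multiset.induction with
  | empty => simp
  | cons a L ih =>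
    intro h
    have h1 := h a (by simp)
    have h2 := ih fun x hx => h x (by simp [hx])
    rw [Multiset.sum_cons]
    linarith

lemma mcard_succ {L : Multiset ℝ} {k : ℕ} (h : Multiset.card L = k + 1) :
    ∃ a L', a ::ₘ L' = L ∧ Multiset.card L' = k := by
  obtain ⟨a, ha⟩ := Multiset.card_pos_iff_exists_mem.1 (show 0 < Multiset.card L by omega)
  obtain ⟨L', rfl⟩ := Multiset.exists_cons_of_mem ha
  exact ⟨a, L', rfl, by simpa using h⟩

lemma map_univ_option {κ : Type} [Fintype κ] (f : Option κ → ℝ) :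
    (Finset.univ : Finset (Option κ)).val.map f =
      f none ::ₘ (Finset.univ : Finset κ).val.map (fun i => f (some i)) := by
  simp [univ_option, Finset.insertNone]

lemma map_univ_equiv {ι κ : Type} [Fintype ι] [Fintype κ] (e : ι ≃ κ) (f : κ → ℝ) :
    (Finset.univ : Finset ι).val.map (fun i => f (e i)) =
      (Finset.univ : Finset κ).val.map f := by
  rw [← Finset.univ_map_equiv_to_embedding e, Finset.map_val, Multiset.map_map]
  rfl

lemma symReal_of {ι : Type} [Fintype ι] [DecidableEq ι] (A : Matrix ι ι ℝ) (E D : Multiset ℝ)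
    (hs : Aᵀ = A) (hn : ∀ i j, 0 ≤ A i j)
    (hE : A.charpoly = (E.map fun a => X - Polynomial.C a).prod)
    (hD : (Finset.univ : Finset ι).val.map (fun i => A i i) = D) : SymReal E D := by
  let e := Fintype.equivFin ι
  refine ⟨Fintype.card ι, Matrix.reindex e e A, ?_, ?_, ?_, ?_⟩
  · ext i j
    simpa using congrFun (congrFun hs (e.symm i)) (e.symm j)
  · intro i j
    exact hn _ _
  · rw [Matrix.charpoly_reindex, hE]
  · rw [← hD, ← map_univ_equiv e.symm]
    rfl

lemma symReal_option {E D : Multiset ℝ} {p : ℝ} (h : SymReal E (p ::ₘ D)) :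
    ∃ (κ : Type) (_ : Fintype κ) (_ : DecidableEq κ) (A : Matrix (Option κ) (Option κ) ℝ),
      Aᵀ = A ∧ (∀ i j, 0 ≤ A i j) ∧
      A.charpoly = (E.map fun a => X - Polynomial.C a).prod ∧ A none none = p ∧
      (Finset.univ : Finset κ).val.map (fun i => A (some i) (some i)) = D := by
  obtain ⟨m, A, hs, hn, hE, hD⟩ := h
  have hp : p ∈ (Finset.univ : Finset (Fin m)).val.map (fun i => A i i) := by
    rw [hD]; exact Multiset.mem_cons_self _ _
  obtain ⟨i0, -, hi0⟩ := Multiset.mem_map.1 hp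
  let e := Equiv.optionSubtypeNe i0
  refine ⟨{b : Fin m // b ≠ i0}, inferInstance, inferInstance, Matrix.reindex e.symm e.symm A,
    ?_, ?_, ?_, ?_, ?_⟩
  · ext i j
    simpa using congrFun (congrFun hs (e i)) (e j)
  · intro i j
    exact hn _ _
  · rw [Matrix.charpoly_reindex, hE]
  · simpa [e] using hi0
  · rw [← map_univ_equiv e, map_univ_option] at hD
    have h0 : A (e none) (e none) = p := by simpa [e] using hi0
    rw [h0] at hD
    exact (Multiset.cons_inj_right p).1 hD

lemma charpoly_option_block {κ : Type} [Fintype κ] [DecidableEq κ] (A : Matrix κ κ ℝ) (μ : ℝ)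
    (B : Matrix (Option κ) (Option κ) ℝ) (h0 : B none none = μ) (h1 : ∀ i, B none (some i) = 0)
    (h2 : ∀ i, B (some i) none = 0) (h3 : ∀ i j, B (some i) (some j) = A i j) :
    B.charpoly = (X - Polynomial.C μ) * A.charpoly := by
  let e := Equiv.optionEquivSumPUnit.{0} κ
  rw [← Matrix.charpoly_reindex e]
  have : Matrix.reindex e e B = Matrix.fromBlocks A 0 0 (Matrix.diagonal fun _ => μ) := by
    ext i j
    rcases i with i | i <;> rcases j with j | j <;> simp [e, h0, h1, h2, h3]
  rw [this, Matrix.charpoly_fromBlocks_zero₁₂, Matrix.charpoly_diagonal]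
  simp [mul_comm]

lemma SymReal.add {E D : Multiset ℝ} {l : ℝ} (h : SymReal E D) (hl : 0 ≤ l) :
    SymReal (l ::ₘ E) (l ::ₘ D) := by
  obtain ⟨m, A, hs, hn, hE, hD⟩ := h
  let B : Matrix (Option (Fin m)) (Option (Fin m)) ℝ := Matrix.of fun i j =>
    match i, j with
    | none, none => l
    | none, some _ => 0
    | some _, none => 0
    | some i, some j => A i j
  refine symReal_of B _ _ ?_ ?_ ?_ ?_
  · ext i j
    rcases i with _ | i <;> rcases j with _ | j <;> simp [B]
    exact congrFun (congrFun hs i) j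
  · intro i j
    rcases i with _ | i <;> rcases j with _ | j <;> simp [B, hl, hn]
  · rw [charpoly_option_block A l B (by simp [B]) (by simp [B]) (by simp [B]) (by simp [B]), hE]
    simp
  · rw [map_univ_option, ← hD]
    rfl

lemma symReal_zero : SymReal 0 0 :=
  ⟨0, 0, by ext i; exact i.elim0, fun i => i.elim0, by simp [Matrix.charpoly], by simp⟩

lemma SymReal.split {E D : Multiset ℝ} {p d μ : ℝ} (h : SymReal E (p ::ₘ D)) (h1 : μ ≤ d)
    (h2 : d ≤ p) (h3 : 0 ≤ d) (h4 : 0 ≤ p + μ - d) :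
    SymReal (μ ::ₘ E) (d ::ₘ (p + μ - d) ::ₘ D) := by
  obtain ⟨κ, _, _, A, hs, hn, hE, hp, hD⟩ := symReal_option h
  obtain ⟨s, c, hs0, hc0, hsc, hd⟩ : ∃ s c : ℝ, 0 ≤ s ∧ 0 ≤ c ∧ s * s + c * c = 1 ∧
      d = p * (s * s) + μ * (c * c) := by
    rcases eq_or_lt_of_le (h1.trans h2) with hpm | hpm
    · exact ⟨0, 1, le_rfl, zero_le_one, by norm_num, by linarith⟩
    · have hq : 0 < p - μ := by linarith
      refine ⟨√((d - μ) / (p - μ)), √((p - d) / (p - μ)), Real.sqrt_nonneg _, Real.sqrt_nonneg _,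
        ?_, ?_⟩
      · rw [Real.mul_self_sqrt (div_nonneg (by linarith) hq.le),
          Real.mul_self_sqrt (div_nonneg (by linarith) hq.le)]
        field_simp
        ring
      · rw [Real.mul_self_sqrt (div_nonneg (by linarith) hq.le),
          Real.mul_self_sqrt (div_nonneg (by linarith) hq.le)]
        field_simp
        ring
  have hsym : ∀ i j, A i j = A j i := fun i j => (congrFun (congrFun hs j) i)
  let B : Matrix (Option (Option κ)) (Option (Option κ)) ℝ := Matrix.of fun i j =>
    match i, j with
    | none, none => μ
    | none, some _ => 0
    | some _, none => 0
    | some i, some j => A i j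
  have hB : B.charpoly = (X - Polynomial.C μ) * A.charpoly :=
    charpoly_option_block A μ B (by simp [B]) (by simp [B]) (by simp [B]) (by simp [B])
  let Z : Matrix (Option (Option κ)) (Option (Option κ)) ℝ := Matrix.of fun i j =>
    match i, j with
    | none, none => d
    | none, some none => s * c * (p - μ)
    | some none, none => s * c * (p - μ)
    | some none, some none => p + μ - d
    | none, some (some j) => s * A none (some j)
    | some none, some (some j) => c * A none (some j)
    | some (some j), none => s * A none (some j)
    | some (some j), some none => c * A none (some j)
    | some (some i), some (some j) => A (some i) (some j)
  let U : Matrix (Option (Option κ)) (Option (Option κ)) ℝ := Matrix.of fun i j =>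
    match i, j with
    | none, none => c
    | none, some none => s
    | some none, none => -s
    | some none, some none => c
    | none, some (some _) => 0
    | some none, some (some _) => 0
    | some (some _), none => 0
    | some (some _), some none => 0
    | some (some i), some (some j) => if i = j then 1 else 0
  have hUU : U * Uᵀ = 1 := by
    ext i j
    rcases i with _ | _ | i <;> rcases j with _ | _ | j <;>
      simp [U, Matrix.mul_apply, Fintype.sum_option, Matrix.one_apply] <;> linarith
  have hZU : Z = U * B * Uᵀ := by
    have hc : c * c = 1 - s * s := by linarith
    have : Z * U = U * B := by
      ext i j
      rcases i with _ | _ | i <;> rcases j with _ | _ | j <;>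
        simp [Z, U, B, Matrix.mul_apply, Fintype.sum_option, hp]
      · linear_combination c * hd + μ * c * hsc
      · linear_combination s * hd + s * p * hsc
      · linear_combination s * hd + s * p * hsc
      · linear_combination -c * hd - c * μ * hsc
      · ring
      · rw [hsym (some i) none]
        linear_combination A none (some i) * hsc
    rw [← this, Matrix.mul_assoc, hUU, Matrix.mul_one]
  refine symReal_of Z _ _ ?_ ?_ ?_ ?_
  · ext i j
    rcases i with _ | _ | i <;> rcases j with _ | _ | j <;> simp [Z]
    exact hsym _ _
  · have := mul_nonneg (mul_nonneg hs0 hc0) (show 0 ≤ p - μ by linarith)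
    intro i j
    rcases i with _ | _ | i <;> rcases j with _ | _ | j <;> simp [Z, h3, h4, hn, this,
      mul_nonneg hs0, mul_nonneg hc0]
  · rw [hZU, Matrix.mul_assoc, Matrix.charpoly_mul_comm, Matrix.mul_assoc,
      _root_.mul_eq_one_comm.1 hUU, Matrix.mul_one, hB, hE]
    simp
  · rw [map_univ_option, map_univ_option, ← hD]
    rfl

/-- Some of the diagonal entries are closed off by entries of the second (diagonal) block. -/
def Stt (E D : Multiset ℝ) : Prop :=
  ∃ E0 D0 Y : Multiset ℝ, SymReal E0 (D + D0) ∧ E = E0 + Y ∧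
    Multiset.Rel (fun y d => |y| ≤ d) Y D0

lemma stt_zero : Stt 0 0 := ⟨0, 0, 0, symReal_zero, rfl, Multiset.Rel.zero⟩

lemma Stt.add {E D : Multiset ℝ} {l : ℝ} (h : Stt E D) (hl : 0 ≤ l) :
    Stt (l ::ₘ E) (l ::ₘ D) := by
  obtain ⟨E0, D0, Y, hR, rfl, hr⟩ := h
  exact ⟨l ::ₘ E0, D0, Y, by simpa using hR.add hl, by simp, hr⟩

lemma Stt.split {E D : Multiset ℝ} {p d μ : ℝ} (h : Stt E (p ::ₘ D)) (h1 : μ ≤ d)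
    (h2 : d ≤ p) (h3 : 0 ≤ d) (h4 : 0 ≤ p + μ - d) :
    Stt (μ ::ₘ E) (d ::ₘ (p + μ - d) ::ₘ D) := by
  obtain ⟨E0, D0, Y, hR, rfl, hr⟩ := h
  rw [Multiset.cons_add] at hR
  exact ⟨μ ::ₘ E0, D0, Y, by simpa using hR.split h1 h2 h3 h4, by simp, hr⟩

lemma Stt.close {E D : Multiset ℝ} {p y : ℝ} (h : Stt E (p ::ₘ D)) (h1 : |y| ≤ p) :
    Stt (y ::ₘ E) D := by
  obtain ⟨E0, D0, Y, hR, rfl, hr⟩ := h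
  exact ⟨E0, p ::ₘ D0, y ::ₘ Y, by simpa using hR, by simp, Multiset.Rel.cons h1 hr⟩

lemma Stt.group (k : ℕ) : ∀ {E D L : Multiset ℝ} {p : ℝ}, Stt E (p ::ₘ D) →
    (∀ a ∈ L, a < 0) → Multiset.card L = 2 * k + 1 → - L.sum ≤ p → Stt (L + E) D := by
  induction k with
  | zero =>
    intro E D L p h hL hc hp
    obtain ⟨a, rfl⟩ := Multiset.card_eq_one.1 hc
    have ha : a < 0 := hL a (by simp)
    have := h.close (y := a) (by rw [abs_of_neg ha]; simpa using hp)
    simpa using this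
  | succ k ih =>
    intro E D L p h hL hc hp
    obtain ⟨a, L1, rfl, hc1⟩ := mcard_succ hc
    obtain ⟨b, L, rfl, hc2⟩ := mcard_succ (k := 2 * k + 1) (by omega)
    have ha : a < 0 := hL a (by simp)
    have hb : b < 0 := hL b (by simp)
    have hL' : ∀ x ∈ L, x < 0 := fun x hx => hL x (by simp [hx])
    have hs : L.sum ≤ 0 := msum_nonpos _ hL'
    simp only [Multiset.sum_cons] at hp
    have h2 := (h.split (μ := b) (d := -a) (by linarith) (by linarith) (by linarith)
      (by linarith)).close (y := a) (by rw [abs_of_neg ha])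
    have := ih h2 hL' (by omega) (by linarith)
    rwa [Multiset.cons_add, Multiset.cons_add, ← Multiset.add_cons, ← Multiset.add_cons]

lemma rel_fun {α : Type} [DecidableEq α] {r : ℝ → α → Prop} (t : Multiset α) :
    ∀ Y : Multiset ℝ, t.Nodup → Multiset.Rel r Y t →
      ∃ y : α → ℝ, Y = t.map y ∧ ∀ b ∈ t, r (y b) b := by
  induction t using Multiset.induction with
  | empty =>
    intro Y _ h
    exact ⟨fun _ => 0, by simpa using h, by simp⟩
  | cons b t ih =>
    intro Y hn h
    obtain ⟨a, Y', hab, hr, rfl⟩ := Multiset.rel_cons_right.1 h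
    rw [Multiset.nodup_cons] at hn
    obtain ⟨y, rfl, hy⟩ := ih Y' hn.2 hr
    refine ⟨Function.update y b a, ?_, ?_⟩
    · rw [Multiset.map_cons, Function.update_self]
      congr 1
      refine Multiset.map_congr rfl fun x hx => ?_
      rw [Function.update_of_ne]
      rintro rfl
      exact hn.1 hx
    · intro x hx
      by_cases hxb : x = b
      · subst hxb; simpa using hab
      · rw [Function.update_of_ne hxb]
        exact hy x (by simpa [hxb] using hx)

/-- The final bisymmetric matrix. -/
lemma Stt.finish {E : Multiset ℝ} {N : ℕ} (h : Stt E 0) (hN : Multiset.card E = N) :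
    ∃ Q : Matrix (Fin N) (Fin N) ℝ, MatNonneg Q ∧ IsBisymm Q ∧ HasEigsM Q E := by
  obtain ⟨E0, D0, Y, ⟨m, A, hs, hn, hE, hD⟩, rfl, hr⟩ := h
  rw [zero_add] at hD
  rw [← hD, Multiset.rel_map_right] at hr
  obtain ⟨y, rfl, hy⟩ := rel_fun _ _ (Finset.univ.nodup) hr
  have hcard : Multiset.card E0 = m := by
    have := congrArg natDegree hE
    rw [Matrix.charpoly_natDegree_eq_dim, natDegree_multiset_prod_X_sub_C_eq_card] at this
    simpa using this.symm
  simp only [Multiset.card_add, hcard, Multiset.card_map, Finset.card_val, Finset.card_univ,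
    Fintype.card_fin] at hN
  subst hN
  let W : Matrix (Fin m) (Fin m) ℝ := Matrix.diagonal y
  let P : Matrix (Fin m) (Fin m) ℝ := (1 / 2 : ℝ) • (A + W)
  let R : Matrix (Fin m) (Fin m) ℝ := (1 / 2 : ℝ) • (A - W)
  let F := Matrix.fromBlocks P R R P
  let e : Fin m ⊕ Fin m ≃ Fin (m + m) :=
    (Equiv.sumCongr (Equiv.refl _) Fin.revPerm).trans finSumFinEquiv
  have hsym : ∀ i j, A i j = A j i := fun i j => (congrFun (congrFun hs j) i)
  have hP : ∀ i j, 0 ≤ P i j := by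
    intro i j
    by_cases hij : i = j
    · subst hij
      have := neg_le_of_abs_le (hy i (Finset.mem_univ i))
      simp [P, W]; linarith
    · simp [P, W, hij, hn]
  have hR : ∀ i j, 0 ≤ R i j := by
    intro i j
    by_cases hij : i = j
    · subst hij
      have := le_of_abs_le (hy i (Finset.mem_univ i))
      simp [R, W]; linarith
    · simp [R, W, hij, hn]
  have hPs : ∀ i j, P i j = P j i := by
    intro i j
    by_cases hij : i = j
    · rw [hij]
    · simp [P, W, hij, Ne.symm hij, hsym i j]
  have hRs : ∀ i j, R i j = R j i := by
    intro i j
    by_cases hij : i = j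
    · rw [hij]
    · simp [R, W, hij, Ne.symm hij, hsym i j]
  have hrev : ∀ i, e.symm i.rev = (e.symm i).swap := by
    intro i
    rw [Equiv.symm_apply_eq]
    obtain ⟨x, rfl⟩ := e.surjective i
    rw [Equiv.symm_apply_apply]
    rcases x with x | x <;> ext <;> simp [e, Fin.val_rev] <;> omega
  refine ⟨Matrix.reindex e e F, ?_, ⟨?_, ?_⟩, ?_⟩
  · intro i j
    simp only [Matrix.reindex_apply, Matrix.submatrix_apply]
    rcases e.symm i with a | a <;> rcases e.symm j with b | b <;> simp [F, hP, hR]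
  · ext i j
    simp only [Matrix.reindex_apply, Matrix.submatrix_apply, Matrix.transpose_apply]
    rcases e.symm i with a | a <;> rcases e.symm j with b | b <;> simp [F, hPs b a, hRs b a]
  · have key : ∀ i k : Fin (m + m), revId (m + m) i k = if k = i.rev then 1 else 0 := by
      intro i k
      simp only [revId, Matrix.of_apply, Fin.ext_iff, Fin.val_rev]
      congr 1
      apply propext
      omega
    have key2 : ∀ i k : Fin (m + m), revId (m + m) i k = if i = k.rev then 1 else 0 := by
      intro i k
      simp only [revId, Matrix.of_apply, Fin.ext_iff, Fin.val_rev]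
      congr 1
      apply propext
      omega
    ext i j
    rw [Matrix.mul_apply]
    simp only [key2 _ j, mul_ite, mul_one, mul_zero, Finset.sum_ite_eq', Finset.mem_univ, if_true]
    rw [Matrix.mul_apply]
    simp only [key, ite_mul, one_mul, zero_mul, Finset.sum_ite_eq', Finset.mem_univ, if_true]
    simp only [Matrix.reindex_apply, Matrix.submatrix_apply, hrev]
    rcases e.symm i with a | a <;> rcases e.symm j with b | b <;> simp [F]
  · rw [HasEigsM, Matrix.charpoly_reindex, Multiset.map_add, Multiset.prod_add, ← hE]
    have hW : W.charpoly = ((Finset.univ.val.map y).map fun a => X - Polynomial.C a).prod := by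
      rw [Matrix.charpoly_diagonal, Multiset.map_map]; rfl
    rw [← hW, ← Matrix.charpoly_fromBlocks_zero₁₂ (M₂₁ := 0)]
    let H : Matrix (Fin m ⊕ Fin m) (Fin m ⊕ Fin m) ℝ := Matrix.fromBlocks 1 1 1 (-1)
    have hH : H * ((1 / 2 : ℝ) • H) = 1 := by
      simp only [H, Matrix.mul_smul, Matrix.fromBlocks_multiply, Matrix.fromBlocks_smul]
      rw [← Matrix.fromBlocks_one]
      congr 1 <;> ext i j <;> simp <;> ring
    have hF : F * H = H * Matrix.fromBlocks A 0 0 W := by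
      simp only [H, F, Matrix.fromBlocks_multiply]
      congr 1 <;> ext i j <;> simp [P, R] <;> ring
    have hF2 : F = H * Matrix.fromBlocks A 0 0 W * ((1 / 2 : ℝ) • H) := by
      rw [← hF, Matrix.mul_assoc, hH, Matrix.mul_one]
    rw [hF2, Matrix.mul_assoc, Matrix.charpoly_mul_comm, Matrix.mul_assoc,
      _root_.mul_eq_one_comm.1 hH, Matrix.mul_one]


lemma stt_core (m : ℕ) (lam : ℕ → ℝ) (Λ : ℕ → Multiset ℝ)
    (hanti : ∀ i j, i ≤ j → j ≤ m + 1 → lam j ≤ lam i)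
    (h0 : 0 ≤ lam (m + 1))
    (hneg : ∀ i < m, ∀ a ∈ Λ i, a < 0) (hodd : ∀ i < m, Odd (Multiset.card (Λ i)))
    (h1 : ∀ k < m, lam (k + 1) + (Λ k).sum < 0 →
      0 ≤ lam 0 + (∑ i ∈ Finset.range k,
        if lam (i + 1) + (Λ i).sum < 0 then lam (i + 1) + (Λ i).sum else 0) + (Λ k).sum) :
    ∀ k ≤ m, lam k ≤ (lam 0 + (∑ i ∈ Finset.range k,
        if lam (i + 1) + (Λ i).sum < 0 then lam (i + 1) + (Λ i).sum else 0)) ∧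
      Stt ((Multiset.range (k + 1)).map lam + ∑ i ∈ Finset.range k, Λ i)
        {lam 0 + (∑ i ∈ Finset.range k,
          if lam (i + 1) + (Λ i).sum < 0 then lam (i + 1) + (Λ i).sum else 0)} := by
  intro k
  induction k with
  | zero =>
    intro _
    have : 0 ≤ lam 0 := h0.trans (hanti 0 _ (Nat.zero_le _) le_rfl)
    refine ⟨by simp, ?_⟩
    simpa using stt_zero.add this
  | succ k ih =>
    intro hk
    obtain ⟨ih1, ih2⟩ := ih (by omega)
    have hl0 : 0 ≤ lam (k + 1) := h0.trans (hanti _ _ (by omega) le_rfl)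
    have hl1 : lam (k + 1) ≤ lam k := hanti _ _ (by omega) (by omega)
    obtain ⟨r, hr⟩ := hodd k (by omega)
    have hh := h1 k (by omega)
    have hT : (Λ k).sum ≤ 0 := msum_nonpos _ (hneg k (by omega))
    rw [Finset.sum_range_succ, Finset.sum_range_succ, Multiset.range_succ (k + 1),
      Multiset.map_cons]
    set S := ∑ i ∈ Finset.range k,
        if lam (i + 1) + (Λ i).sum < 0 then lam (i + 1) + (Λ i).sum else 0 with hS
    set F := (Multiset.range (k + 1)).map lam
    have hE : lam (k + 1) ::ₘ F + (∑ i ∈ Finset.range k, Λ i + Λ k) =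
        Λ k + lam (k + 1) ::ₘ (F + ∑ i ∈ Finset.range k, Λ i) := by
      simp only [← Multiset.singleton_add]
      abel
    rw [hE]
    by_cases hK : lam (k + 1) + (Λ k).sum < 0
    · have h2 := hh hK
      rw [if_pos hK]
      refine ⟨by linarith, ?_⟩
      have h3 := Stt.split (D := 0) (μ := lam (k + 1)) (d := -(Λ k).sum) ih2 (by linarith)
        (by linarith) (by linarith) (by linarith)
      have h4 := Stt.group r h3 (hneg k (by omega)) hr le_rfl
      convert h4 using 1
      rw [Multiset.cons_zero, Multiset.singleton_inj]
      ring
    · rw [if_neg hK, add_zero]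
      refine ⟨by linarith, ?_⟩
      exact Stt.group r (ih2.add hl0) (hneg k (by omega)) hr (by linarith)

lemma stt_main (n m : ℕ) (hMn : m + 1 ≤ n)
    (lam : ℕ → ℝ)
    (hanti : ∀ i j, i ≤ j → j ≤ n → lam j ≤ lam i)
    (hM0 : 0 ≤ lam (m + 1))
    (hneg : ∀ i, m + 1 < i → i ≤ n → lam i < 0)
    (Λ : Fin m → Multiset ℝ)
    (hpart : (∑ j, Λ j) = (Finset.Icc (m + 1 + 1) n).val.map lam)
    (hodd : ∀ j : Fin m, Odd (Multiset.card (Λ j)))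
    (T : Fin m → ℝ) (hT : ∀ j, T j = (Λ j).sum)
    (K : Finset (Fin m))
    (hK : K = Finset.univ.filter fun i : Fin m => lam ((i : ℕ) + 1) + T i < 0)
    (h1 : ∀ k ∈ K,
      0 ≤ lam 0 + (∑ i ∈ K.filter fun i => i < k, (lam ((i : ℕ) + 1) + T i)) + T k) :
    Stt ((Multiset.range (n + 1)).map lam) 0 := by
  let L : ℕ → Multiset ℝ := fun i => if h : i < m then Λ ⟨i, h⟩ else 0
  have hL : ∀ i : Fin m, L i = Λ i := fun i => by simp [L]
  have hsum : ∑ i ∈ Finset.range m, L i = ∑ j, Λ j := by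
    rw [← Fin.sum_univ_eq_sum_range]
    exact Finset.sum_congr rfl fun i _ => hL i
  have hLneg : ∀ i < m, ∀ a ∈ L i, a < 0 := by
    intro i hi a ha
    have : a ∈ ∑ j, Λ j := by
      rw [Multiset.mem_sum]
      exact ⟨⟨i, hi⟩, Finset.mem_univ _, by rwa [← hL ⟨i, hi⟩]⟩
    rw [hpart] at this
    obtain ⟨j, hj, rfl⟩ := Multiset.mem_map.1 this
    rw [Finset.mem_val, Finset.mem_Icc] at hj
    exact hneg j (by omega) hj.2
  have key := stt_core m lam L (fun i j hij hj => hanti i j hij (by omega)) hM0 hLneg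
    (fun i hi => by rw [show L i = Λ ⟨i, hi⟩ from hL ⟨i, hi⟩]; exact hodd _) ?_ m le_rfl
  · obtain ⟨k1, k2⟩ := key
    have h3 : lam (m + 1) ≤ lam m := hanti _ _ (by omega) (by omega)
    have k3 := Stt.close (D := 0) (y := lam (m + 1)) k2 (by rw [abs_of_nonneg hM0]; linarith)
    rw [hsum, hpart] at k3
    convert k3 using 1
    rw [← Multiset.cons_add, ← Multiset.map_cons, ← Multiset.range_succ, ← Multiset.map_add]
    congr 1
    have hd : Disjoint (Finset.range (m + 1 + 1)) (Finset.Icc (m + 1 + 1) n) := by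
      rw [Finset.disjoint_left]
      intro a ha hb
      simp at ha hb
      omega
    have hu : Finset.range (n + 1) =
        (Finset.range (m + 1 + 1)).disjUnion (Finset.Icc (m + 1 + 1) n) hd := by
      ext a
      simp
      omega
    exact congrArg Finset.val hu
  · intro k hk hneg'
    rw [show L k = Λ ⟨k, hk⟩ from hL ⟨k, hk⟩, ← hT] at hneg' ⊢
    have := h1 ⟨k, hk⟩ (by rw [hK]; simpa using hneg')
    convert this using 4
    rw [hK, Finset.filter_filter, Finset.sum_filter]
    have : ∀ i : Fin m, (if lam ((i : ℕ) + 1) + T i < 0 ∧ i < ⟨k, hk⟩ then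
        lam ((i : ℕ) + 1) + T i else 0) =
        (fun i : ℕ => if i < k then (if lam (i + 1) + (L i).sum < 0 then
          lam (i + 1) + (L i).sum else 0) else 0) i := by
      intro i
      simp only [hL, ← hT, Fin.lt_def]
      by_cases ha : lam ((i : ℕ) + 1) + T i < 0 <;> by_cases hb : (i : ℕ) < k <;>
        simp only [ha, hb, and_self, and_true, and_false, if_true, if_false]
    rw [Finset.sum_congr rfl fun i _ => this i, Fin.sum_univ_eq_sum_range (fun i : ℕ =>
      if i < k then (if lam (i + 1) + (L i).sum < 0 then
          lam (i + 1) + (L i).sum else 0) else 0) m]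
    refine Eq.trans ?_ (Finset.sum_filter _ _)
    refine Finset.sum_congr ?_ fun _ _ => rfl
    ext a
    simp
    omega

/-- Borobia-type condition for the BNIEP with `M - 1` parts (Theorem 3.4): with a
partition `Λ₁ ∪ … ∪ Λ_{M-1}` of the negative part into parts of odd size, part sums
`T_{M-1} ≥ … ≥ T₁`, and Kellogg-type inequalities, the list `λ₀, …, λₙ` is realizable by
a nonnegative bisymmetric matrix. (Here `Λ j`, `T j`, `j : Fin (M-1)`, represent
`Λ_{j+1}`, `T_{j+1}`.) -/
theorem bniep_borobia_M_minus_one (n M : ℕ) (hM : 1 ≤ M) (hMn : M ≤ n)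
    (lam : ℕ → ℝ)
    (hanti : ∀ i j, i ≤ j → j ≤ n → lam j ≤ lam i)
    (hM0 : 0 ≤ lam M)
    (hneg : ∀ i, M < i → i ≤ n → lam i < 0)
    (Λ : Fin (M - 1) → Multiset ℝ)
    (hpart : (∑ j, Λ j) = (Finset.Icc (M + 1) n).val.map lam)
    (hodd : ∀ j : Fin (M - 1), Odd (Multiset.card (Λ j)))
    (T : Fin (M - 1) → ℝ) (hT : ∀ j, T j = (Λ j).sum)
    (hTmono : Monotone T)
    (K : Finset (Fin (M - 1)))
    (hK : K = Finset.univ.filter fun i : Fin (M - 1) => lam ((i : ℕ) + 1) + T i < 0)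
    (h1 : ∀ k ∈ K,
      0 ≤ lam 0 + (∑ i ∈ K.filter fun i => i < k, (lam ((i : ℕ) + 1) + T i)) + T k)
    (h2 : 0 ≤ lam 0 + ∑ i ∈ K, (lam ((i : ℕ) + 1) + T i)) :
    ∃ Q : Matrix (Fin (n + 1)) (Fin (n + 1)) ℝ,
      MatNonneg Q ∧ IsBisymm Q ∧ HasEigs Q fun i => lam (i : ℕ) := by
  obtain ⟨m, rfl⟩ : ∃ m, M = m + 1 := ⟨M - 1, by omega⟩
  have h := stt_main n m hMn lam hanti hM0 hneg Λ hpart hodd T hT K hK h1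
  obtain ⟨Q, hQ1, hQ2, hQ3⟩ := h.finish (N := n + 1) (by simp)
  refine ⟨Q, hQ1, hQ2, ?_⟩
  rw [HasEigs, hQ3, Multiset.map_map, Fin.prod_univ_eq_prod_range
    (fun i => X - Polynomial.C (lam i)) (n + 1)]
  rfl
end
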